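/- Let p ∈ ℂ[z₁, z₂] be a stable polynomial of total degree d. Then there exist d×d complex matrices A, B₁, B₂ and a constant c ∈ ℂ such that: (i) Im A := (A − A*)/(2i) is positive semidefinite; (ii) B₁ and B₂ are positive semidefinite; (iii) B₁ + B₂ = I; and (iv) p(z₁, z₂) = c · det(A + z₁B₁ + z₂B₂) for all (z₁, z₂) ∈ ℂ². -/

import Mathlib

namespace BivariateStable

open Polynomial Matrix
open scoped ComplexOrder

/-! ### The conjugation of coefficients on `ℂ[X]` -/

noncomputable instance : StarRing ℂ[X] where
  star p := p.map (starRingEnd ℂ)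
  star_involutive p := by
    ext n
    simp
  star_mul p q := by
    rw [Polynomial.map_mul, mul_comm]
  star_add p q := Polynomial.map_add _

theorem star_def (p : ℂ[X]) : star p = p.map (starRingEnd ℂ) := rfl

theorem star_C (a : ℂ) : star (C a) = C (star a) := by
  simp [star_def]

theorem star_X : star (X : ℂ[X]) = X := by
  simp [star_def]

theorem coeff_star (p : ℂ[X]) (n : ℕ) : (star p).coeff n = star (p.coeff n) := by
  simp [star_def]

theorem natDegree_star (p : ℂ[X]) : (star p).natDegree = p.natDegree :=
  Polynomial.natDegree_map_eq_of_injective (starRingEnd ℂ).injective p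

theorem eval_star (p : ℂ[X]) (z : ℂ) : (star p).eval z = star (p.eval (star z)) := by
  have := Polynomial.eval_map_apply (p := p) (f := starRingEnd ℂ) (star z)
  simpa [star_def] using this

theorem eval_star_real (p : ℂ[X]) (x : ℝ) : (star p).eval (x : ℂ) = star (p.eval (x : ℂ)) := by
  simp [eval_star]

theorem eq_of_eval_real {p q : ℂ[X]} (h : ∀ x : ℝ, p.eval (x : ℂ) = q.eval (x : ℂ)) : p = q := by
  refine Polynomial.eq_of_infinite_eval_eq p q
    ((Set.infinite_range_of_injective Complex.ofReal_injective).mono ?_)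
  rintro _ ⟨x, rfl⟩
  exact h x

/-- Entrywise evaluation of a polynomial matrix. -/
noncomputable abbrev evalMat {ι : Type*} [Fintype ι] [DecidableEq ι] (z : ℂ) :
    Matrix ι ι ℂ[X] →+* Matrix ι ι ℂ :=
  (evalRingHom z).mapMatrix

section PolynomialMatrix

variable {ι : Type*} [Fintype ι] [DecidableEq ι]

theorem evalMat_apply (z : ℂ) (M : Matrix ι ι ℂ[X]) (i j : ι) :
    evalMat z M i j = (M i j).eval z := rfl

theorem evalMat_conjTranspose (M : Matrix ι ι ℂ[X]) (x : ℝ) :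
    evalMat (x : ℂ) Mᴴ = (evalMat (x : ℂ) M)ᴴ := by
  ext i j
  simp [eval_star_real]

theorem eval_det (z : ℂ) (M : Matrix ι ι ℂ[X]) : M.det.eval z = (evalMat z M).det :=
  RingHom.map_det (evalRingHom z) M

theorem matrix_eq_of_eval_real {M N : Matrix ι ι ℂ[X]}
    (h : ∀ x : ℝ, evalMat (x : ℂ) M = evalMat (x : ℂ) N) : M = N := by
  ext1 i j
  exact eq_of_eval_real fun x => congrFun (congrFun (h x) i) j

theorem isHermitian_of_eval_real {M : Matrix ι ι ℂ[X]}
    (h : ∀ x : ℝ, (evalMat (x : ℂ) M).IsHermitian) : Mᴴ = M :=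
  matrix_eq_of_eval_real fun x => by rw [evalMat_conjTranspose, (h x).eq]

/-! ### Degree bookkeeping -/

theorem coeff_eq_zero_of_odd_bound {p : ℂ[X]} {n : ℕ} (hdeg : p.natDegree ≤ 2 * n + 1)
    (hpos : ∀ x : ℝ, 0 ≤ p.eval (x : ℂ)) : p.coeff (2 * n + 1) = 0 := by
  set r := Polynomial.reflect (2 * n + 1) p with hr
  have hr0 : r.eval 0 = p.coeff (2 * n + 1) := by
    rw [← Polynomial.coeff_zero_eq_eval_zero, hr, Polynomial.coeff_reflect]
    simp [Polynomial.revAt_le]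
  have hreval (x : ℝ) (hx : x ≠ 0) :
      r.eval (x : ℂ) = ((x ^ (2 * n + 1) : ℝ) : ℂ) * p.eval ((x⁻¹ : ℝ) : ℂ) := by
    have hx' : ((x⁻¹ : ℝ) : ℂ) ≠ 0 := by simpa using hx
    let _ := invertibleOfNonzero hx'
    have h := Polynomial.eval₂_reflect_mul_pow (RingHom.id ℂ) ((x⁻¹ : ℝ) : ℂ) (2 * n + 1) p hdeg
    rw [invOf_eq_inv] at h
    change r.eval _ * _ = p.eval _ at h
    have hx0 : (x : ℂ) ≠ 0 := by exact_mod_cast hx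
    rw [← h, Complex.ofReal_inv, inv_inv, Complex.ofReal_pow, mul_left_comm, ← mul_pow,
      mul_inv_cancel₀ hx0, one_pow, mul_one]
  have hc : Continuous fun x : ℝ => r.eval (x : ℂ) := r.continuous.comp Complex.continuous_ofReal
  have hc0 : Filter.Tendsto (fun x : ℝ => r.eval (x : ℂ)) (nhds 0) (nhds (p.coeff (2 * n + 1))) := by
    have := hc.tendsto 0
    rwa [Complex.ofReal_zero, hr0] at this
  refine le_antisymm ?_ ?_
  · refine le_of_tendsto (hc0.mono_left (nhdsWithin_le_nhds (s := Set.Iio 0))) ?_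
    filter_upwards [self_mem_nhdsWithin] with x hx
    rw [hreval x (ne_of_lt hx)]
    refine mul_nonpos_of_nonpos_of_nonneg ?_ (hpos _)
    exact Complex.real_le_real.mpr (Odd.pow_neg ⟨n, rfl⟩ (Set.mem_Iio.mp hx)).le
  · refine ge_of_tendsto (hc0.mono_left (nhdsWithin_le_nhds (s := Set.Ioi 0))) ?_
    filter_upwards [self_mem_nhdsWithin] with x hx
    rw [hreval x (ne_of_gt hx)]
    refine mul_nonneg ?_ (hpos _)
    exact Complex.real_le_real.mpr (pow_pos (Set.mem_Ioi.mp hx) _).le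

theorem natDegree_le_pred_of_coeff_eq_zero {p : ℂ[X]} {n : ℕ} (h : p.natDegree ≤ n)
    (h0 : p.coeff n = 0) : p = 0 ∨ p.natDegree + 1 ≤ n := by
  by_cases hp : p = 0
  · exact Or.inl hp
  · refine Or.inr (Nat.succ_le_of_lt (lt_of_le_of_ne h ?_))
    rintro rfl
    exact hp (Polynomial.leadingCoeff_eq_zero.mp h0)

theorem natDegree_prod_le_and_coeff {ι : Type*} (s : Finset ι) (p : ι → ℂ[X]) (n : ι → ℕ)
    (h : ∀ i ∈ s, (p i).natDegree ≤ n i) :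
    (∏ i ∈ s, p i).natDegree ≤ ∑ i ∈ s, n i ∧
      (∏ i ∈ s, p i).coeff (∑ i ∈ s, n i) = ∏ i ∈ s, (p i).coeff (n i) := by
  classical
  induction s using Finset.induction_on with
  | empty => simp
  | insert a s ha ih =>
    obtain ⟨h1, h2⟩ := ih fun i hi => h i (Finset.mem_insert_of_mem hi)
    have h3 := h a (Finset.mem_insert_self a s)
    simp only [Finset.prod_insert ha, Finset.sum_insert ha]
    exact ⟨Polynomial.natDegree_mul_le_of_le h3 h1,
      by rw [Polynomial.coeff_mul_add_eq_of_natDegree_le h3 h1, h2]⟩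

theorem coeff_det (G : Matrix ι ι ℂ[X]) (m : ι → ℕ)
    (hdeg : ∀ i j, (G i j).natDegree ≤ m i + m j) :
    G.det.coeff (∑ i, (m i + m i)) = (Matrix.of fun i j => (G i j).coeff (m i + m j)).det := by
  have key (σ : Equiv.Perm ι) : ∑ i, (m i + m i) = ∑ i, (m (σ i) + m i) := by
    rw [Finset.sum_add_distrib, Finset.sum_add_distrib, Equiv.sum_comp σ m]
  rw [Matrix.det_apply', Matrix.det_apply', Polynomial.finsetSum_coeff]
  refine Finset.sum_congr rfl fun σ _ => ?_
  rw [Polynomial.coeff_intCast_mul, key σ,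
    (natDegree_prod_le_and_coeff Finset.univ (fun i => G (σ i) i) _ fun i _ => hdeg _ _).2]
  rfl

theorem natDegree_le_of_sum_mul_star {κ : Type*} (s : Finset κ) (p : κ → ℂ[X]) (n : ℕ)
    (h : (∑ k ∈ s, p k * star (p k)).natDegree ≤ 2 * n) : ∀ k ∈ s, (p k).natDegree ≤ n := by
  by_contra! hcon
  obtain ⟨k₀, hk₀, hlt⟩ := hcon
  obtain ⟨k₁, hk₁, hmax⟩ := s.exists_max_image (fun k => (p k).natDegree) ⟨k₀, hk₀⟩
  set N := (p k₁).natDegree with hN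
  have hnN : n < N := hlt.trans_le (hmax k₀ hk₀)
  have h0 : (∑ k ∈ s, p k * star (p k)).coeff (N + N) = 0 :=
    Polynomial.coeff_eq_zero_of_natDegree_lt (by omega)
  rw [Polynomial.finsetSum_coeff] at h0
  have h1 : ∀ k ∈ s, (p k * star (p k)).coeff (N + N) = ((‖(p k).coeff N‖ ^ 2 : ℝ) : ℂ) := by
    intro k hk
    rw [Polynomial.coeff_mul_add_eq_of_natDegree_le (hmax k hk)
      ((natDegree_star _).le.trans (hmax k hk)), coeff_star, Complex.star_def, Complex.mul_conj']
    push_cast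
    rfl
  rw [Finset.sum_congr rfl h1, ← Complex.ofReal_sum, Complex.ofReal_eq_zero,
    Finset.sum_eq_zero_iff_of_nonneg fun _ _ => by positivity] at h0
  have h2 := h0 k₁ hk₁
  have h3 : p k₁ = 0 := by
    apply Polynomial.leadingCoeff_eq_zero.mp
    have h4 : (p k₁).coeff N = 0 := by simpa using h2
    exact h4
  rw [h3] at hN
  simp at hN
  omega

/-! ### Spectral factorization of positive polynomial matrices on the real line -/

theorem posDef_entry_pos {G : Matrix ι ι ℂ[X]} {x : ℝ} (h : (evalMat (x : ℂ) G).PosDef) (i : ι) :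
    0 < (G i i).eval (x : ℂ) := h.diag_pos (i := i)

theorem exists_factor_of_const {G : Matrix ι ι ℂ[X]} (hconst : ∀ i j, (G i j).natDegree ≤ 0)
    (hpos : ∀ x : ℝ, (evalMat (x : ℂ) G).PosDef) :
    ∃ S : Matrix ι ι ℂ[X], G = Sᴴ * S ∧ ∀ z : ℂ, 0 ≤ z.im → S.det.eval z ≠ 0 := by
  open scoped MatrixOrder in
  obtain ⟨B, hB⟩ := CStarAlgebra.nonneg_iff_eq_star_mul_self.mp (hpos 0).posSemidef.nonneg
  have hG (x : ℝ) : evalMat (x : ℂ) G = Bᴴ * B := by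
    rw [← star_eq_conjTranspose, ← hB]
    ext i j
    simp only [evalMat_apply]
    rw [Polynomial.eq_C_of_natDegree_le_zero (hconst i j)]
    simp
  have hev (z : ℂ) : evalMat z (B.map C) = B := by
    ext i j
    simp
  refine ⟨B.map C, matrix_eq_of_eval_real fun x => ?_, fun z _ h0 => ?_⟩
  · rw [hG, map_mul, evalMat_conjTranspose, hev]
  · rw [eval_det, hev] at h0
    have := (hpos 0).det_pos
    rw [hG, det_mul, h0, mul_zero] at this
    exact this.ne rfl

/-- The elementary matrix that replaces the basis vector `i` by `e i + w`. -/
def colShear {R : Type*} [CommRing R] (i : ι) (w : ι → R) : Matrix ι ι R :=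
  1 + vecMulVec w (Pi.single i 1)

theorem colShear_mul_neg {R : Type*} [CommRing R] {i : ι} {w : ι → R} (hw : w i = 0) :
    colShear i w * colShear i (-w) = 1 := by
  have h : vecMulVec w (Pi.single i (1 : R)) * vecMulVec w (Pi.single i 1) = 0 := by
    rw [vecMulVec_mul_vecMulVec]
    simp [hw]
  rw [colShear, colShear, neg_vecMulVec, add_mul, mul_add, mul_add, mul_neg, mul_neg, h]
  simp

theorem natDegree_colShear {ι : Type*} [DecidableEq ι] {i : ι} {w : ι → ℂ[X]} {m : ι → ℕ}
    (hw : ∀ j, w j = 0 ∨ (w j).natDegree + m j ≤ m i) (j k : ι) :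
    colShear i w j k = 0 ∨ (colShear i w j k).natDegree + m j ≤ m k := by
  by_cases hk : k = i
  · subst hk
    by_cases hj : j = k
    · subst hj
      right
      have h1 : (w j).natDegree ≤ 0 := by
        rcases hw j with h | h
        · simp [h]
        · omega
      have : (1 + w j).natDegree ≤ 0 := (natDegree_add_le _ _).trans (by simpa using h1)
      simp only [colShear, Matrix.add_apply, one_apply_eq, vecMulVec_apply, Pi.single_eq_same, mul_one]
      omega
    · simpa [colShear, one_apply_ne hj, vecMulVec_apply] using hw j
  · by_cases hj : j = k
    · subst hj
      simp [colShear, vecMulVec_apply, hk]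
    · simp [colShear, vecMulVec_apply, hk, one_apply_ne hj]

theorem natDegree_mul_graded {ι : Type*} [Fintype ι] {V G : Matrix ι ι ℂ[X]} {m : ι → ℕ}
    (hV : ∀ j k, V j k = 0 ∨ (V j k).natDegree + m j ≤ m k)
    (hG : ∀ i j, (G i j).natDegree ≤ m i + m j) (i k : ι) :
    ((G * V) i k).natDegree ≤ m i + m k := by
  rw [mul_apply]
  refine natDegree_sum_le_of_forall_le _ _ fun j _ => ?_
  rcases hV j k with h | h
  · simp [h]
  · have := hG i j
    exact natDegree_mul_le.trans (by omega)

theorem natDegree_graded_mul {ι : Type*} [Fintype ι] {V G : Matrix ι ι ℂ[X]} {m : ι → ℕ}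
    (hV : ∀ j k, V j k = 0 ∨ (V j k).natDegree + m j ≤ m k)
    (hG : ∀ i j, (G i j).natDegree ≤ m i + m j) (i k : ι) :
    ((Vᴴ * G) i k).natDegree ≤ m i + m k := by
  rw [mul_apply]
  refine natDegree_sum_le_of_forall_le _ _ fun j _ => ?_
  rw [conjTranspose_apply]
  rcases hV j i with h | h
  · simp [h]
  · have := hG j k
    refine natDegree_mul_le.trans ?_
    rw [natDegree_star]
    omega

theorem coeff_graded_mul {ι : Type*} [Fintype ι] {V G : Matrix ι ι ℂ[X]} {m : ι → ℕ}
    (hV : ∀ j k, V j k = 0 ∨ (V j k).natDegree + m j ≤ m k)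
    (hG : ∀ i j, (G i j).natDegree ≤ m i + m j) {k : ι}
    (hk : ∀ j, (G j k).coeff (m j + m k) = 0) (i : ι) :
    ((Vᴴ * G) i k).coeff (m i + m k) = 0 := by
  rw [mul_apply, finsetSum_coeff]
  refine Finset.sum_eq_zero fun j _ => ?_
  rw [conjTranspose_apply]
  rcases hV j i with h | h
  · simp [h]
  · have h1 : m i + m k = (m i - m j) + (m j + m k) := by omega
    rw [h1, coeff_mul_add_eq_of_natDegree_le (by rw [natDegree_star]; omega) (hG j k), hk, mul_zero]

theorem posDef_conj {G V : Matrix ι ι ℂ[X]} {x : ℝ} (hG : (evalMat (x : ℂ) G).PosDef)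
    (hV : IsUnit (evalMat (x : ℂ) V)) : (evalMat (x : ℂ) (Vᴴ * G * V)).PosDef := by
  rw [map_mul, map_mul, evalMat_conjTranspose]
  exact hV.posDef_star_left_conjugate_iff.mpr hG

/-- If the weighted leading coefficient matrix is singular, the weights can be lowered. -/
theorem exists_reduction_at_infinity {G : Matrix ι ι ℂ[X]} {m : ι → ℕ}
    (hdeg : ∀ i j, (G i j).natDegree ≤ m i + m j)
    (hpos : ∀ x : ℝ, (evalMat (x : ℂ) G).PosDef)
    (hsing : (Matrix.of fun i j => (G i j).coeff (m i + m j)).det = 0) :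
    ∃ (G' W : Matrix ι ι ℂ[X]) (m' : ι → ℕ), G = Wᴴ * G' * W ∧
      (∀ z : ℂ, 0 ≤ z.im → W.det.eval z ≠ 0) ∧ (∀ i j, (G' i j).natDegree ≤ m' i + m' j) ∧
      (∀ x : ℝ, (evalMat (x : ℂ) G').PosDef) ∧ ∑ i, m' i < ∑ i, m i := by
  obtain ⟨c, hc0, hc⟩ := exists_mulVec_eq_zero_iff.mpr hsing
  obtain ⟨i₁, hi₁⟩ := Function.ne_iff.mp hc0
  obtain ⟨i, hi, hmax⟩ := (Finset.univ.filter fun j => c j ≠ 0).exists_max_image m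
    ⟨i₁, by simpa using hi₁⟩
  have hci : c i ≠ 0 := by simpa using hi
  have hmax' (j : ι) (hj : c j ≠ 0) : m j ≤ m i := hmax j (by simpa using hj)
  set w : ι → ℂ[X] := fun j => if j = i then 0 else C (c j / c i) * X ^ (m i - m j) with hwdef
  have hwi : w i = 0 := by simp [hwdef]
  have hw (j : ι) : w j = 0 ∨ (w j).natDegree + m j ≤ m i := by
    by_cases hj : c j = 0
    · left
      simp [hwdef, hj]
    · have := hmax' j hj
      by_cases hji : j = i
      · exact Or.inl (by rw [hji, hwi])
      · right
        have h1 : (w j).natDegree ≤ m i - m j := by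
          simp only [hwdef, if_neg hji]
          exact natDegree_C_mul_X_pow_le _ _
        omega
  set V := colShear i w with hVdef
  have hVV : V * colShear i (-w) = 1 := colShear_mul_neg hwi
  have hV := natDegree_colShear hw
  have hunit (z : ℂ) : IsUnit (evalMat z V) := (IsUnit.of_mul_eq_one _ hVV).map (evalMat z)
  have hcol (k : ι) : ((G * V) k i).coeff (m k + m i) = 0 := by
    have h1 (j : ι) : (G k j * V j i).coeff (m k + m i) =
        (c i)⁻¹ * ((G k j).coeff (m k + m j) * c j) := by
      have hVji : V j i = C (c j / c i) * X ^ (m i - m j) := by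
        by_cases hji : j = i
        · subst hji
          simp [hVdef, colShear, vecMulVec_apply, hwi, hci]
        · simp [hVdef, colShear, vecMulVec_apply, one_apply_ne hji, hwdef, hji]
      rw [hVji]
      by_cases hj : c j = 0
      · simp [hj]
      · have := hmax' j hj
        rw [mul_left_comm, coeff_C_mul, show m k + m i = (m k + m j) + (m i - m j) by omega,
          coeff_mul_X_pow]
        field_simp
    rw [mul_apply, finsetSum_coeff, Finset.sum_congr rfl fun j _ => h1 j, ← Finset.mul_sum]
    have h2 := congrFun hc k
    simp only [mulVec, dotProduct, of_apply, Pi.zero_apply] at h2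
    rw [h2, mul_zero]
  set H := Vᴴ * G * V with hHdef
  have hH' : H = Vᴴ * (G * V) := Matrix.mul_assoc _ _ _
  have hHdeg (k l : ι) : (H k l).natDegree ≤ m k + m l := by
    rw [hH']
    exact natDegree_graded_mul hV (natDegree_mul_graded hV hdeg) k l
  have hHcol (k : ι) : (H k i).coeff (m k + m i) = 0 := by
    rw [hH']
    exact coeff_graded_mul hV (natDegree_mul_graded hV hdeg) hcol k
  have hHpos (x : ℝ) : (evalMat (x : ℂ) H).PosDef := posDef_conj (hpos x) (hunit x)
  have hHherm : Hᴴ = H := isHermitian_of_eval_real fun x => (hHpos x).isHermitian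
  have hHii : H i i ≠ 0 := by
    intro h0
    have := posDef_entry_pos (hHpos 0) i
    rw [h0, eval_zero] at this
    exact this.ne rfl
  have hcol' (k : ι) : H k i = 0 ∨ (H k i).natDegree + 1 ≤ m k + m i :=
    natDegree_le_pred_of_coeff_eq_zero (hHdeg k i) (hHcol k)
  have hrow' (k : ι) : H i k = 0 ∨ (H i k).natDegree + 1 ≤ m k + m i := by
    have h1 : H i k = star (H k i) := by
      conv_lhs => rw [← hHherm, conjTranspose_apply]
    rw [h1, natDegree_star, star_eq_zero]
    exact hcol' k
  have hmi : 1 ≤ m i := by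
    have := (hcol' i).resolve_left hHii
    omega
  have hii : (H i i).natDegree + 2 ≤ m i + m i := by
    have h1 := (hcol' i).resolve_left hHii
    have h2 : (H i i).natDegree ≤ 2 * (m i - 1) + 1 := by omega
    have h3 := coeff_eq_zero_of_odd_bound h2 fun x => (posDef_entry_pos (hHpos x) i).le
    have := (natDegree_le_pred_of_coeff_eq_zero h2 h3).resolve_left hHii
    omega
  refine ⟨H, colShear i (-w), Function.update m i (m i - 1), ?_, fun z _ => ?_, fun k l => ?_,
    hHpos, ?_⟩
  · have h1 : (colShear i (-w))ᴴ * Vᴴ = 1 := by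
      rw [← conjTranspose_mul, hVV, conjTranspose_one]
    calc G = ((colShear i (-w))ᴴ * Vᴴ) * G * (V * colShear i (-w)) := by
          rw [h1, hVV, Matrix.one_mul, Matrix.mul_one]
      _ = _ := by simp only [hHdef, Matrix.mul_assoc]
  · have h1 := congrArg (fun M => M.det.eval z) hVV
    simp only [det_mul, eval_mul, det_one, eval_one] at h1
    exact right_ne_zero_of_mul_eq_one h1
  · by_cases hk : k = i
    · subst hk
      by_cases hl : l = k
      · subst hl
        simp only [Function.update_self]
        omega
      · rw [Function.update_self, Function.update_of_ne hl]
        rcases hrow' l with h | h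
        · simp [h]
        · omega
    · rw [Function.update_of_ne hk]
      by_cases hl : l = i
      · subst hl
        rw [Function.update_self]
        rcases hcol' k with h | h
        · simp [h]
        · omega
      · rw [Function.update_of_ne hl]
        exact hHdeg k l
  · refine Finset.sum_lt_sum (fun j _ => ?_) ⟨i, Finset.mem_univ i, ?_⟩
    · by_cases hj : j = i
      · subst hj
        simp
      · simp [hj]
    · rw [Function.update_self]
      omega

theorem isCoprime_X_sub_C_star {a : ℂ} (ha : a.im ≠ 0) :
    IsCoprime (X - C (star a) : ℂ[X]) (X - C a) := by
  refine isCoprime_X_sub_C_of_isUnit_sub (isUnit_iff_ne_zero.mpr fun h => ha ?_)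
  have := congrArg Complex.im h
  simp at this
  linarith

/-- A zero of the determinant in the open lower half-plane can be split off. -/
theorem exists_reduction_at_root {G : Matrix ι ι ℂ[X]} {m : ι → ℕ} {a : ℂ} (ha : a.im < 0)
    (hdeg : ∀ i j, (G i j).natDegree ≤ m i + m j)
    (hpos : ∀ x : ℝ, (evalMat (x : ℂ) G).PosDef)
    (hsing : G.det.eval a = 0) :
    ∃ (G' W : Matrix ι ι ℂ[X]) (m' : ι → ℕ), G = Wᴴ * G' * W ∧
      (∀ z : ℂ, 0 ≤ z.im → W.det.eval z ≠ 0) ∧ (∀ i j, (G' i j).natDegree ≤ m' i + m' j) ∧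
      (∀ x : ℝ, (evalMat (x : ℂ) G').PosDef) ∧ ∑ i, m' i < ∑ i, m i := by
  rw [eval_det] at hsing
  obtain ⟨c, hc0, hc⟩ := exists_mulVec_eq_zero_iff.mpr hsing
  obtain ⟨i₁, hi₁⟩ := Function.ne_iff.mp hc0
  obtain ⟨i, hi, hmax⟩ := (Finset.univ.filter fun j => c j ≠ 0).exists_max_image m
    ⟨i₁, by simpa using hi₁⟩
  have hci : c i ≠ 0 := by simpa using hi
  have hmax' (j : ι) (hj : c j ≠ 0) : m j ≤ m i := hmax j (by simpa using hj)
  set w : ι → ℂ[X] := fun j => if j = i then 0 else C (c j / c i) with hwdef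
  have hwi : w i = 0 := by simp [hwdef]
  have hw (j : ι) : w j = 0 ∨ (w j).natDegree + m j ≤ m i := by
    by_cases hj : c j = 0
    · left
      simp [hwdef, hj]
    · have := hmax' j hj
      by_cases hji : j = i
      · exact Or.inl (by rw [hji, hwi])
      · right
        simpa only [hwdef, if_neg hji, natDegree_C, zero_add] using this
  set V := colShear i w with hVdef
  have hVV : V * colShear i (-w) = 1 := colShear_mul_neg hwi
  have hV := natDegree_colShear hw
  have hunit (z : ℂ) : IsUnit (evalMat z V) := (IsUnit.of_mul_eq_one _ hVV).map (evalMat z)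
  have hcol (k : ι) : ((G * V) k i).eval a = 0 := by
    have h1 (j : ι) : (G k j * V j i).eval a = (c i)⁻¹ * ((G k j).eval a * c j) := by
      have hVji : V j i = C (c j / c i) := by
        by_cases hji : j = i
        · subst hji
          simp [hVdef, colShear, vecMulVec_apply, hwi, hci]
        · simp [hVdef, colShear, vecMulVec_apply, one_apply_ne hji, hwdef, hji]
      rw [hVji, eval_mul, eval_C]
      field_simp
    rw [mul_apply, eval_finsetSum, Finset.sum_congr rfl fun j _ => h1 j, ← Finset.mul_sum]
    have h2 := congrFun hc k
    simp only [mulVec, dotProduct, evalMat_apply, Pi.zero_apply] at h2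
    rw [h2, mul_zero]
  set H := Vᴴ * G * V with hHdef
  have hH' : H = Vᴴ * (G * V) := Matrix.mul_assoc _ _ _
  have hHdeg (k l : ι) : (H k l).natDegree ≤ m k + m l := by
    rw [hH']
    exact natDegree_graded_mul hV (natDegree_mul_graded hV hdeg) k l
  have hHpos (x : ℝ) : (evalMat (x : ℂ) H).PosDef := posDef_conj (hpos x) (hunit x)
  have hHherm : Hᴴ = H := isHermitian_of_eval_real fun x => (hHpos x).isHermitian
  have hHii : H i i ≠ 0 := by
    intro h0
    have := posDef_entry_pos (hHpos 0) i
    rw [h0, eval_zero] at this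
    exact this.ne rfl
  have hHcol (k : ι) : X - C a ∣ H k i := by
    rw [dvd_iff_isRoot, IsRoot.def, hH', mul_apply, eval_finsetSum]
    exact Finset.sum_eq_zero fun j _ => by rw [eval_mul, hcol, mul_zero]
  have hHrow (k : ι) : X - C (star a) ∣ H i k := by
    have h1 : H i k = star (H k i) := by
      conv_lhs => rw [← hHherm, conjTranspose_apply]
    obtain ⟨r, hr⟩ := hHcol k
    exact ⟨star r, by rw [h1, hr, star_mul', star_sub, star_X, star_C]⟩
  set e : ι → ℂ[X] := fun l => if l = i then X - C a else 1 with hedef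
  set δ : ι → ℕ := fun l => if l = i then 1 else 0 with hδdef
  have he_monic (l : ι) : (e l).Monic := by
    by_cases hl : l = i
    · simpa [hedef, hl] using monic_X_sub_C a
    · simp [hedef, hl]
  have hse (l : ι) : star (e l) = if l = i then X - C (star a) else 1 := by
    by_cases hl : l = i
    · simp [hedef, hl, star_X, star_C]
    · simp [hedef, hl]
  have hse_monic (l : ι) : (star (e l)).Monic := by
    rw [hse]
    split_ifs
    exacts [monic_X_sub_C _, monic_one]
  have he_deg (l : ι) : (e l).natDegree = δ l := by
    by_cases hl : l = i
    · simp [hedef, hδdef, hl]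
    · simp [hedef, hδdef, hl]
  have hdvd (k l : ι) : star (e k) * e l ∣ H k l := by
    rw [hse]
    by_cases hk : k = i
    · by_cases hl : l = i
      · subst hk hl
        simp only [hedef, if_true]
        exact (isCoprime_X_sub_C_star ha.ne).mul_dvd (hHrow l) (hHcol l)
      · subst hk
        simpa [hedef, hl] using hHrow l
    · by_cases hl : l = i
      · subst hl
        simpa [hedef, hk] using hHcol k
      · simp [hedef, hk, hl]
  choose G' hG' using hdvd
  have hHE : H = (diagonal e)ᴴ * of G' * diagonal e := by
    ext1 k l
    rw [diagonal_conjTranspose, mul_diagonal, diagonal_mul, hG', of_apply, Pi.star_apply]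
    ring
  have hEunit (z : ℂ) (hz : 0 ≤ z.im) : (diagonal e).det.eval z ≠ 0 := by
    rw [det_diagonal, eval_prod]
    refine Finset.prod_ne_zero_iff.mpr fun l _ => ?_
    by_cases hl : l = i
    · simp only [hedef, hl, if_true, eval_sub, eval_X, eval_C]
      intro h0
      rw [sub_eq_zero] at h0
      rw [h0] at hz
      linarith
    · simp [hedef, hl]
  have hdegree (k l : ι) : G' k l = 0 ∨ (G' k l).natDegree + δ k + δ l ≤ m k + m l := by
    by_cases h0 : G' k l = 0
    · exact Or.inl h0
    · right
      have h1 := hHdeg k l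
      rw [hG', ((hse_monic k).mul (he_monic l)).natDegree_mul' h0,
        (hse_monic k).natDegree_mul (he_monic l), natDegree_star, he_deg, he_deg] at h1
      omega
  have hmi : 1 ≤ m i := by
    have h1 : G' i i ≠ 0 := fun h0 => hHii (by rw [hG', h0, mul_zero])
    have h2 := (hdegree i i).resolve_left h1
    simp only [hδdef, if_true] at h2
    omega
  have hδm (l : ι) : δ l ≤ m l := by
    by_cases hl : l = i
    · simpa [hδdef, hl] using hmi
    · simp [hδdef, hl]
  refine ⟨of G', diagonal e * colShear i (-w), fun l => m l - δ l, ?_, fun z hz => ?_,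
    fun k l => ?_, fun x => ?_, ?_⟩
  · have h1 : (colShear i (-w))ᴴ * Vᴴ = 1 := by
      rw [← conjTranspose_mul, hVV, conjTranspose_one]
    calc G = ((colShear i (-w))ᴴ * Vᴴ) * G * (V * colShear i (-w)) := by
          rw [h1, hVV, Matrix.one_mul, Matrix.mul_one]
      _ = (colShear i (-w))ᴴ * H * colShear i (-w) := by simp only [hHdef, Matrix.mul_assoc]
      _ = _ := by
          rw [hHE, conjTranspose_mul]
          simp only [Matrix.mul_assoc]
  · have h1 := congrArg (fun M => M.det.eval z) hVV
    simp only [det_mul, eval_mul, det_one, eval_one] at h1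
    rw [det_mul, eval_mul]
    exact mul_ne_zero (hEunit z hz) (right_ne_zero_of_mul_eq_one h1)
  · have hk := hδm k
    have hl := hδm l
    rcases hdegree k l with h | h
    · simp [h]
    · change (G' k l).natDegree ≤ (m k - δ k) + (m l - δ l)
      omega
  · have h1 := hHpos x
    rw [hHE, map_mul, map_mul, evalMat_conjTranspose] at h1
    refine (IsUnit.posDef_star_left_conjugate_iff ?_).mp h1
    rw [isUnit_iff_isUnit_det, ← eval_det]
    exact isUnit_iff_ne_zero.mpr (hEunit x (by simp))
  · refine Finset.sum_lt_sum (fun j _ => Nat.sub_le _ _) ⟨i, Finset.mem_univ i, ?_⟩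
    simp only [hδdef, if_true]
    omega

theorem exists_spectral_factor_of_weights (N : ℕ) :
    ∀ (G : Matrix ι ι ℂ[X]) (m : ι → ℕ), ∑ i, m i ≤ N →
      (∀ i j, (G i j).natDegree ≤ m i + m j) → (∀ x : ℝ, (evalMat (x : ℂ) G).PosDef) →
      ∃ S : Matrix ι ι ℂ[X], G = Sᴴ * S ∧ ∀ z : ℂ, 0 ≤ z.im → S.det.eval z ≠ 0 := by
  induction N with
  | zero =>
    intro G m hm hdeg hpos
    refine exists_factor_of_const (fun i j => ?_) hpos
    have h0 : ∀ i, m i = 0 := by simpa using hm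
    simpa [h0] using hdeg i j
  | succ N ih =>
    intro G m hm hdeg hpos
    have step : (∃ (G' W : Matrix ι ι ℂ[X]) (m' : ι → ℕ), G = Wᴴ * G' * W ∧
        (∀ z : ℂ, 0 ≤ z.im → W.det.eval z ≠ 0) ∧ (∀ i j, (G' i j).natDegree ≤ m' i + m' j) ∧
        (∀ x : ℝ, (evalMat (x : ℂ) G').PosDef) ∧ ∑ i, m' i < ∑ i, m i) →
        ∃ S : Matrix ι ι ℂ[X], G = Sᴴ * S ∧ ∀ z : ℂ, 0 ≤ z.im → S.det.eval z ≠ 0 := by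
      rintro ⟨G', W, m', rfl, hW, hdeg', hpos', hlt⟩
      obtain ⟨S, rfl, hS⟩ := ih G' m' (by omega) hdeg' hpos'
      refine ⟨S * W, by simp only [conjTranspose_mul, Matrix.mul_assoc], fun z hz => ?_⟩
      rw [det_mul, eval_mul]
      exact mul_ne_zero (hS z hz) (hW z hz)
    by_cases hsing : (Matrix.of fun i j => (G i j).coeff (m i + m j)).det = 0
    · exact step (exists_reduction_at_infinity hdeg hpos hsing)
    by_cases hsum : ∑ i, m i ≤ N
    · exact ih G m hsum hdeg hpos
    have hcoeff := coeff_det G m hdeg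
    rw [Finset.sum_add_distrib] at hcoeff
    have hdet_deg : G.det.natDegree ≠ 0 := by
      intro h0
      rw [← hcoeff] at hsing
      exact hsing (coeff_eq_zero_of_natDegree_lt (by omega))
    obtain ⟨a, ha⟩ := IsAlgClosed.exists_root G.det fun h => hdet_deg
      (natDegree_eq_of_degree_eq_some h)
    rw [IsRoot.def] at ha
    have hherm : Gᴴ = G := isHermitian_of_eval_real fun x => (hpos x).isHermitian
    have hstar : G.det.eval (star a) = 0 := by
      have h1 : star G.det = G.det := by rw [← det_conjTranspose, hherm]
      rw [← h1, eval_star, star_star, ha, star_zero]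
    rcases lt_trichotomy a.im 0 with him | him | him
    · exact step (exists_reduction_at_root him hdeg hpos ha)
    · exfalso
      have h1 := (hpos a.re).det_pos
      rw [← eval_det, show ((a.re : ℝ) : ℂ) = a from Complex.ext (by simp) (by simp [him]), ha] at h1
      exact h1.ne rfl
    · exact step (exists_reduction_at_root (by simpa using him) hdeg hpos hstar)

/-- Matrix Fejér–Riesz theorem on the real line, for everywhere positive definite matrices. -/
theorem exists_spectral_factor {G : Matrix ι ι ℂ[X]}
    (hpos : ∀ x : ℝ, (evalMat (x : ℂ) G).PosDef) :
    ∃ S : Matrix ι ι ℂ[X], G = Sᴴ * S ∧ ∀ z : ℂ, 0 ≤ z.im → S.det.eval z ≠ 0 := by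
  refine exists_spectral_factor_of_weights _ G (fun _ => ∑ i, ∑ j, (G i j).natDegree) le_rfl
    (fun i j => ?_) hpos
  refine le_trans ?_ (Nat.le_add_right _ _)
  exact (Finset.single_le_sum (f := fun j => (G i j).natDegree) (fun _ _ => Nat.zero_le _)
    (Finset.mem_univ j)).trans (Finset.single_le_sum (f := fun i => ∑ j, (G i j).natDegree)
    (fun _ _ => Nat.zero_le _) (Finset.mem_univ i))

end PolynomialMatrix

/-! ### Companion and Bezout matrices -/

section Companion

variable {R : Type*} [CommRing R] {n : ℕ}

/-- The companion matrix whose last row carries the coefficients of `f`. -/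
def companion (n : ℕ) (f : R[X]) : Matrix (Fin (n + 1)) (Fin (n + 1)) R :=
  of fun i j => Fin.lastCases (-f.coeff j) (fun i' => if j = i'.succ then 1 else 0) i

theorem companion_last (f : R[X]) (j : Fin (n + 1)) :
    companion n f (Fin.last n) j = -f.coeff j := by
  simp [companion]

theorem companion_castSucc (f : R[X]) (i : Fin n) (j : Fin (n + 1)) :
    companion n f i.castSucc j = if j = i.succ then 1 else 0 := by
  simp [companion]

theorem mul_companion_zero (f : R[X]) (M : Matrix (Fin (n + 1)) (Fin (n + 1)) R)
    (i : Fin (n + 1)) : (M * companion n f) i 0 = -(M i (Fin.last n) * f.coeff 0) := by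
  rw [mul_apply, Fin.sum_univ_castSucc, companion_last]
  simp [companion_castSucc, (Fin.succ_ne_zero _).symm]

theorem mul_companion_succ (f : R[X]) (M : Matrix (Fin (n + 1)) (Fin (n + 1)) R)
    (i : Fin (n + 1)) (j : Fin n) :
    (M * companion n f) i j.succ = M i j.castSucc - M i (Fin.last n) * f.coeff (j + 1) := by
  rw [mul_apply, Fin.sum_univ_castSucc, companion_last]
  simp [companion_castSucc, Fin.succ_inj, sub_eq_add_neg]

theorem companion_pow_zero_row (f : R[X]) (k j : Fin (n + 1)) :
    (companion n f ^ (k : ℕ)) 0 j = if j = k then 1 else 0 := by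
  induction k using Fin.induction generalizing j with
  | zero => simp [one_apply, eq_comm]
  | succ k ih =>
    rw [Fin.val_castSucc] at ih
    rw [Fin.val_succ, pow_succ]
    have hlast : (companion n f ^ (k : ℕ)) 0 (Fin.last n) = 0 := by
      rw [ih, if_neg (Fin.castSucc_lt_last k).ne']
    induction j using Fin.cases with
    | zero => rw [mul_companion_zero, hlast, if_neg (Fin.succ_ne_zero k).symm]; simp
    | succ j => rw [mul_companion_succ, hlast, ih]; simp [Fin.succ_inj]

theorem aeval_companion_zero_row (f : R[X]) {g : R[X]} (hg : g.natDegree ≤ n) (j : Fin (n + 1)) :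
    (aeval (companion n f) g) 0 j = g.coeff j := by
  rw [aeval_eq_sum_range' (Nat.lt_succ_of_le hg), ← Fin.sum_univ_eq_sum_range
    (fun k => g.coeff k • companion n f ^ k), Matrix.sum_apply]
  simp [companion_pow_zero_row]

theorem charpoly_companion [Nontrivial R] {f : R[X]} (hf : f.Monic) (hdeg : f.natDegree = n + 1) :
    (companion n f).charpoly = f := by
  set p := (companion n f).charpoly with hp
  have hpm : p.Monic := charpoly_monic _
  have hpd : p.natDegree = n + 1 := by simp [hp, charpoly_natDegree_eq_dim]
  have hlead (r : R[X]) (hr : r.Monic) (hrd : r.natDegree = n + 1) : r.coeff (n + 1) = 1 := by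
    rw [← hrd]
    exact hr
  have h0 : aeval (companion n f) p = 0 := aeval_self_charpoly _
  ext k
  rcases lt_trichotomy k (n + 1) with hk | hk | hk
  · have h1 := congrFun (congrFun h0 0) ⟨k, hk⟩
    rw [aeval_eq_sum_range, hpd, Finset.sum_range_succ, hlead p hpm hpd, one_smul,
      ← Fin.sum_univ_eq_sum_range (fun k => p.coeff k • companion n f ^ k), Matrix.add_apply,
      Matrix.sum_apply] at h1
    have h2 : (companion n f ^ (n + 1)) 0 ⟨k, hk⟩ = -f.coeff k := by
      have h3 := companion_pow_zero_row (n := n) f (Fin.last n)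
      rw [Fin.val_last] at h3
      rw [pow_succ, mul_apply]
      simp [h3, companion_last]
    rw [h2] at h1
    simp only [Matrix.smul_apply, companion_pow_zero_row, smul_eq_mul, mul_ite, mul_one, mul_zero,
      Finset.sum_ite_eq, Finset.mem_univ, if_true, Matrix.zero_apply] at h1
    linear_combination h1
  · rw [hk, hlead p hpm hpd, hlead f hf hdeg]
  · rw [coeff_eq_zero_of_natDegree_lt (by omega), coeff_eq_zero_of_natDegree_lt (by omega)]

/-- The Bezout matrix of `f` and the constant polynomial `1`. -/
def coeffHankel (n : ℕ) (f : R[X]) : Matrix (Fin (n + 1)) (Fin (n + 1)) R :=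
  of fun i j => f.coeff (i + j + 1)

theorem coeffHankel_transpose (f : R[X]) : (coeffHankel n f)ᵀ = coeffHankel n f := by
  ext i j
  simp [coeffHankel, add_comm (i : ℕ)]

theorem coeffHankel_last {f : R[X]} (hf : f.Monic) (hdeg : f.natDegree = n + 1)
    (j : Fin (n + 1)) : coeffHankel n f (Fin.last n) j = if j = 0 then 1 else 0 := by
  rw [coeffHankel, of_apply, Fin.val_last]
  split_ifs with hj
  · subst hj
    have : f.coeff f.natDegree = 1 := hf
    rwa [hdeg] at this
  · have : 0 < (j : ℕ) := Fin.pos_iff_ne_zero.mpr hj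
    exact coeff_eq_zero_of_natDegree_lt (by omega)

theorem coeffHankel_mul_companion {f : R[X]} (hf : f.Monic) (hdeg : f.natDegree = n + 1) :
    coeffHankel n f * companion n f = (companion n f)ᵀ * coeffHankel n f := by
  have hlast (i : Fin (n + 1)) : coeffHankel n f i (Fin.last n) = if i = 0 then 1 else 0 := by
    rw [← coeffHankel_last hf hdeg i]
    conv_lhs => rw [← coeffHankel_transpose, transpose_apply]
  have hright (i j : Fin (n + 1)) : ((companion n f)ᵀ * coeffHankel n f) i j =
      (coeffHankel n f * companion n f) j i := by
    rw [← transpose_apply (coeffHankel n f * companion n f), transpose_mul, coeffHankel_transpose]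
  ext i j
  rw [hright]
  induction i using Fin.cases with
  | zero =>
    induction j using Fin.cases with
    | zero => rfl
    | succ j =>
      rw [mul_companion_succ, mul_companion_zero, hlast, hlast]
      simp [coeffHankel]
  | succ i =>
    induction j using Fin.cases with
    | zero =>
      rw [mul_companion_succ, mul_companion_zero, hlast, hlast]
      simp [coeffHankel]
    | succ j =>
      rw [mul_companion_succ, mul_companion_succ, hlast, hlast]
      simp only [coeffHankel, of_apply, Fin.succ_ne_zero, if_false, zero_mul, sub_zero,
        Fin.val_succ, Fin.val_castSucc]
      congr 1
      omega

/-- The Bezout matrix of `f` and `g`, in the basis of monomials. -/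
noncomputable def bezout (n : ℕ) (f g : R[X]) : Matrix (Fin (n + 1)) (Fin (n + 1)) R :=
  coeffHankel n f * aeval (companion n f) g

theorem bezout_mul_companion {f : R[X]} (hf : f.Monic) (hdeg : f.natDegree = n + 1) (g : R[X]) :
    bezout n f g * companion n f = (companion n f)ᵀ * bezout n f g := by
  have h : aeval (companion n f) g * companion n f = companion n f * aeval (companion n f) g := by
    simpa only [map_mul, aeval_X] using congrArg (aeval (companion n f)) (mul_comm g X)
  rw [bezout, Matrix.mul_assoc, h, ← Matrix.mul_assoc, coeffHankel_mul_companion hf hdeg,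
    Matrix.mul_assoc]

theorem bezout_last {f g : R[X]} (hf : f.Monic) (hdeg : f.natDegree = n + 1)
    (hg : g.natDegree ≤ n) (j : Fin (n + 1)) : bezout n f g (Fin.last n) j = g.coeff j := by
  rw [bezout, mul_apply]
  simp [coeffHankel_last hf hdeg, aeval_companion_zero_row f hg]

theorem bezout_map {S : Type*} [CommRing S] (φ : R →+* S) (f g : R[X]) :
    (bezout n f g).map φ = bezout n (f.map φ) (g.map φ) := by
  have h1 : (companion n f).map φ = companion n (f.map φ) := by
    ext i j
    induction i using Fin.lastCases with
    | last => simp [companion_last]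
    | cast i => simp [companion_castSucc, apply_ite φ]
  have h2 : (coeffHankel n f).map φ = coeffHankel n (f.map φ) := by
    ext i j
    simp [coeffHankel]
  have h3 : (aeval (companion n f) g).map φ = aeval (companion n (f.map φ)) (g.map φ) := by
    rw [← h1]
    change φ.mapMatrix _ = aeval (φ.mapMatrix _) _
    rw [aeval_def, hom_eval₂, aeval_def, eval₂_map]
    congr 1
    ext r i j
    simp [Matrix.algebraMap_matrix_apply, apply_ite φ]
  rw [bezout, bezout, Matrix.map_mul, h2, h3]

end Companion

/-! ### Hermite–Biehler -/

theorem induction_of_roots_im_neg {motive : ℂ[X] → Prop}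
    (const : ∀ a : ℂ, a ≠ 0 → motive (C a))
    (mul : ∀ (a : ℂ) (q : ℂ[X]), a.im < 0 → (∀ z, q.eval z = 0 → z.im < 0) → motive q →
      motive ((X - C a) * q))
    (q : ℂ[X]) (hq : ∀ z, q.eval z = 0 → z.im < 0) : motive q := by
  induction hn : q.natDegree generalizing q with
  | zero =>
    obtain ⟨a, rfl⟩ := natDegree_eq_zero.mp hn
    refine const a ?_
    rintro rfl
    simpa using hq 0 (by simp)
  | succ n ih =>
    have hdeg : q.degree ≠ 0 := by
      intro h
      rw [natDegree_eq_of_degree_eq_some h] at hn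
      simp at hn
    obtain ⟨a, ha⟩ := IsAlgClosed.exists_root q hdeg
    obtain ⟨r, rfl⟩ := dvd_iff_isRoot.mpr ha
    have hr : r ≠ 0 := by
      rintro rfl
      simp at hn
    have hroots : ∀ z, r.eval z = 0 → z.im < 0 := fun z hz => hq z (by simp [hz])
    refine mul a r (hq a ha) hroots (ih r hroots ?_)
    rw [natDegree_mul (X_sub_C_ne_zero a) hr, natDegree_X_sub_C] at hn
    omega

theorem norm_eval_star_lt {q : ℂ[X]} (hq : ∀ z, q.eval z = 0 → z.im < 0)
    (hdeg : q.natDegree ≠ 0) {y : ℂ} (hy : 0 < y.im) :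
    ‖q.eval (star y)‖ < ‖q.eval y‖ := by
  suffices h : ‖q.eval (star y)‖ ≤ ‖q.eval y‖ ∧
      (q.natDegree ≠ 0 → ‖q.eval (star y)‖ < ‖q.eval y‖) from h.2 hdeg
  refine induction_of_roots_im_neg (motive := fun q => ‖q.eval (star y)‖ ≤ ‖q.eval y‖ ∧
    (q.natDegree ≠ 0 → ‖q.eval (star y)‖ < ‖q.eval y‖)) (fun a _ => by simp) ?_ q hq
  · intro a q ha hq ih
    have h1 : ‖star y - a‖ < ‖y - a‖ := by
      rw [← sq_lt_sq₀ (norm_nonneg _) (norm_nonneg _), ← Complex.normSq_eq_norm_sq,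
        ← Complex.normSq_eq_norm_sq, Complex.normSq_apply, Complex.normSq_apply]
      simp only [RCLike.star_def, Complex.sub_re, Complex.sub_im, Complex.conj_re,
        Complex.conj_im]
      nlinarith [mul_pos hy (neg_pos.mpr ha)]
    have h2 : 0 < ‖q.eval y‖ := by
      rw [norm_pos_iff]
      intro h
      linarith [hq y h]
    have h3 : ‖star y - a‖ * ‖q.eval (star y)‖ < ‖y - a‖ * ‖q.eval y‖ :=
      
      (mul_le_mul_of_nonneg_left ih.1 (norm_nonneg _)).trans_lt (mul_lt_mul_of_pos_right h1 h2)
    simp only [eval_mul, eval_sub, eval_X, eval_C, norm_mul]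
    exact ⟨h3.le, fun _ => h3⟩

theorem im_derivative_mul_star_neg {q : ℂ[X]} (hq : ∀ z, q.eval z = 0 → z.im < 0)
    (hdeg : q.natDegree ≠ 0) (y : ℝ) :
    ((derivative q).eval (y : ℂ) * star (q.eval (y : ℂ))).im < 0 := by
  suffices h : ((derivative q).eval (y : ℂ) * star (q.eval (y : ℂ))).im ≤ 0 ∧
      (q.natDegree ≠ 0 → ((derivative q).eval (y : ℂ) * star (q.eval (y : ℂ))).im < 0) from
    h.2 hdeg
  refine induction_of_roots_im_neg (motive := fun q =>
    ((derivative q).eval (y : ℂ) * star (q.eval (y : ℂ))).im ≤ 0 ∧ (q.natDegree ≠ 0 →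
      ((derivative q).eval (y : ℂ) * star (q.eval (y : ℂ))).im < 0)) (fun a _ => by simp) ?_ q hq
  · intro a q ha hq ih
    have h2 : 0 < Complex.normSq (q.eval (y : ℂ)) := by
      rw [Complex.normSq_pos]
      intro h
      simpa using hq y h
    have h3 : (derivative ((X - C a) * q)).eval (y : ℂ) * star (((X - C a) * q).eval (y : ℂ)) =
        (Complex.normSq (q.eval (y : ℂ)) : ℂ) * star ((y : ℂ) - a) +
        (Complex.normSq ((y : ℂ) - a) : ℂ) *
          ((derivative q).eval (y : ℂ) * star (q.eval (y : ℂ))) := by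
      simp only [derivative_mul, derivative_sub, derivative_X, derivative_C, eval_add, eval_mul,
        eval_sub, eval_X, eval_C, eval_one, sub_zero, star_mul', RCLike.star_def,
        Complex.normSq_eq_conj_mul_self]
      ring
    have h4 : ((derivative ((X - C a) * q)).eval (y : ℂ) *
        star (((X - C a) * q).eval (y : ℂ))).im < 0 := by
      rw [h3, Complex.add_im, Complex.im_ofReal_mul, Complex.im_ofReal_mul]
      have h5 : (star ((y : ℂ) - a)).im = a.im := by simp
      rw [h5]
      have := mul_nonpos_of_nonneg_of_nonpos (Complex.normSq_nonneg ((y : ℂ) - a)) ih.1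
      nlinarith [mul_pos h2 (neg_pos.mpr ha)]
    exact ⟨h4.le, fun _ => h4⟩

section Vandermonde

variable {K : Type*} [Field K] {n : ℕ}

theorem companion_mul_vandermonde {f : K[X]} (hf : f.Monic) (hdeg : f.natDegree = n + 1)
    {y : Fin (n + 1) → K} (hy : ∀ a, f.eval (y a) = 0) :
    companion n f * (vandermonde y)ᵀ = (vandermonde y)ᵀ * diagonal y := by
  ext i a
  rw [mul_diagonal, mul_apply]
  simp only [transpose_apply, vandermonde_apply]
  induction i using Fin.lastCases with
  | last =>
    have h := hy a
    have hlead : f.coeff (n + 1) = 1 := by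
      rw [← hdeg]
      exact hf
    rw [eval_eq_sum_range, hdeg, Finset.sum_range_succ, hlead,
      ← Fin.sum_univ_eq_sum_range (fun k => f.coeff k * y a ^ k)] at h
    simp only [companion_last, neg_mul, Finset.sum_neg_distrib, Fin.val_last]
    linear_combination -h
  | cast i => simp [companion_castSucc, pow_succ]

theorem aeval_mul_eq_mul_aeval {m : Type*} [Fintype m] [DecidableEq m] {M V D : Matrix m m K}
    (h : M * V = V * D) (g : K[X]) : aeval M g * V = V * aeval D g := by
  rw [aeval_eq_sum_range, aeval_eq_sum_range, Finset.sum_mul, Finset.mul_sum]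
  refine Finset.sum_congr rfl fun k _ => ?_
  have h' : SemiconjBy V D M := h.symm
  rw [smul_mul_assoc, mul_smul_comm, (h'.pow_right k).eq]

theorem aeval_diagonal {m : Type*} [Fintype m] [DecidableEq m] (y : m → K) (g : K[X]) :
    aeval (diagonal y) g = diagonal fun a => g.eval (y a) := by
  rw [aeval_eq_sum_range]
  ext i j
  rw [Matrix.sum_apply]
  rcases eq_or_ne i j with rfl | hij
  · simp [diagonal_pow, eval_eq_sum_range]
  · simp [diagonal_pow, hij]

theorem vandermonde_mul_coeffHankel_mul {f : K[X]} (hf : f.Monic) (hdeg : f.natDegree = n + 1)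
    {y : Fin (n + 1) → K} (hy : ∀ a, f.eval (y a) = 0) (hinj : Function.Injective y) :
    vandermonde y * coeffHankel n f * (vandermonde y)ᵀ =
      diagonal fun a => (derivative f).eval (y a) := by
  set W := vandermonde y * coeffHankel n f * (vandermonde y)ᵀ with hW
  have hcomm : W * diagonal y = diagonal y * W := by
    have h := companion_mul_vandermonde hf hdeg hy
    have h' := congrArg transpose h
    rw [transpose_mul, transpose_mul, transpose_transpose, diagonal_transpose] at h'
    rw [hW, Matrix.mul_assoc, ← h, ← Matrix.mul_assoc, Matrix.mul_assoc (vandermonde y),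
      coeffHankel_mul_companion hf hdeg, ← Matrix.mul_assoc, h']
    simp only [Matrix.mul_assoc]
  ext a b
  rcases eq_or_ne a b with rfl | hab
  · rw [diagonal_apply_eq, hW, mul_apply]
    simp only [mul_apply, transpose_apply, vandermonde_apply, coeffHankel, of_apply,
      Finset.sum_mul]
    set F : ℕ → K := fun s => f.coeff (s + 1) * y a ^ s with hF
    have hzero (s : ℕ) (hs : n + 1 ≤ s) : F s = 0 := by
      simp only [hF]
      rw [coeff_eq_zero_of_natDegree_lt (by omega), zero_mul]
    calc ∑ k : Fin (n + 1), ∑ j : Fin (n + 1), y a ^ (j : ℕ) * f.coeff (j + k + 1) *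
          y a ^ (k : ℕ)
        = ∑ k : Fin (n + 1), ∑ j : Fin (n + 1), F (k + j) := by
          refine Finset.sum_congr rfl fun k _ => Finset.sum_congr rfl fun j _ => ?_
          simp only [hF, pow_add, add_comm (k : ℕ)]
          ring
      _ = ∑ k ∈ Finset.range (n + 1), ∑ j ∈ Finset.range (n + 1), F (k + j) := by
          rw [← Fin.sum_univ_eq_sum_range (fun k => ∑ j ∈ Finset.range (n + 1), F (k + j))]
          exact Finset.sum_congr rfl fun k _ => Fin.sum_univ_eq_sum_range (fun j => F (k + j)) _
      _ = ∑ k ∈ Finset.range (n + 1), ∑ j ∈ Finset.range (n + 1 - k), F (k + j) := by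
          refine Finset.sum_congr rfl fun k _ => (Finset.sum_subset
            (Finset.range_subset_range.mpr (Nat.sub_le _ _)) fun j _ hj => hzero _ ?_).symm
          rw [Finset.mem_range] at hj
          omega
      _ = ∑ s ∈ Finset.range (n + 1), ∑ k ∈ Finset.range (s + 1), F (k + (s - k)) :=
          (Finset.sum_range_diag_flip (n + 1) fun k j => F (k + j)).symm
      _ = ∑ s ∈ Finset.range (n + 1), f.coeff (s + 1) * (s + 1) * y a ^ s := by
          refine Finset.sum_congr rfl fun s _ => ?_
          rw [Finset.sum_congr rfl fun k hk => by
            rw [Nat.add_sub_cancel' (Nat.lt_succ_iff.mp (Finset.mem_range.mp hk))]]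
          simp [hF]
          ring
      _ = (derivative f).eval (y a) := by
          rw [eval_eq_sum_range' (n := n + 1)]
          · simp [coeff_derivative]
          · exact (natDegree_derivative_le f).trans_lt (by omega)
  · have h := congrFun (congrFun hcomm a) b
    rw [mul_diagonal, diagonal_mul] at h
    rw [diagonal_apply_ne _ hab]
    have h' : (y b - y a) * W a b = 0 := by linear_combination h
    exact (mul_eq_zero.mp h').resolve_left (sub_ne_zero.mpr (hinj.ne hab.symm))

theorem vandermonde_mul_bezout_mul {f : K[X]} (hf : f.Monic) (hdeg : f.natDegree = n + 1)
    {y : Fin (n + 1) → K} (hy : ∀ a, f.eval (y a) = 0) (hinj : Function.Injective y) (g : K[X]) :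
    vandermonde y * bezout n f g * (vandermonde y)ᵀ =
      diagonal fun a => (derivative f).eval (y a) * g.eval (y a) := by
  rw [bezout, Matrix.mul_assoc, Matrix.mul_assoc,
    aeval_mul_eq_mul_aeval (companion_mul_vandermonde hf hdeg hy), aeval_diagonal,
    ← Matrix.mul_assoc, ← Matrix.mul_assoc, vandermonde_mul_coeffHankel_mul hf hdeg hy hinj,
    diagonal_mul_diagonal]

end Vandermonde

/-- Hermite–Biehler theorem: the Bezoutian of the real and imaginary parts of a stable polynomial
is positive definite. -/
theorem bezout_posDef {n : ℕ} {f g : ℂ[X]} (hf : f.Monic) (hdeg : f.natDegree = n + 1)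
    (hgdeg : g.natDegree ≤ n) (hfstar : star f = f) (hgstar : star g = g)
    (hq : ∀ z, (f + C Complex.I * g).eval z = 0 → z.im < 0) : (bezout n f g).PosDef := by
  set q := f + C Complex.I * g with hqdef
  have hqdeg : q.natDegree ≠ 0 := by
    rw [hqdef, natDegree_add_eq_left_of_natDegree_lt]
    · omega
    · exact (natDegree_C_mul_le _ _).trans_lt (by omega)
  have hconj {h : ℂ[X]} (hh : star h = h) (z : ℂ) : h.eval (star z) = star (h.eval z) := by
    conv_lhs => rw [← hh, eval_star, star_star]
  have hnotpos (z : ℂ) (hz : f.eval z = 0) : ¬0 < z.im := by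
    intro him
    have := norm_eval_star_lt hq hqdeg him
    simp only [hqdef, eval_add, eval_mul, eval_C, hconj hfstar, hconj hgstar, hz, star_zero, zero_add,
      norm_mul, norm_star, lt_self_iff_false] at this
  have hreal (z : ℂ) (hz : f.eval z = 0) : ((z.re : ℝ) : ℂ) = z := by
    have h1 := hnotpos z hz
    have h2 := hnotpos (star z) (by rw [hconj hfstar, hz, star_zero])
    simp only [RCLike.star_def, Complex.conj_im] at h2
    apply Complex.ext
    · simp
    · simp only [Complex.ofReal_im]
      linarith
  have hpos (z : ℂ) (hz : f.eval z = 0) : 0 < (derivative f).eval z * g.eval z := by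
    have hx := hreal z hz
    set x := z.re
    rw [← hx] at hz ⊢
    have h1 := im_derivative_mul_star_neg hq hqdeg x
    have hfix {h : ℂ[X]} (hh : star h = h) : star (h.eval (x : ℂ)) = h.eval (x : ℂ) := by
      rw [← eval_star_real, hh]
    have hf' : star (derivative f) = derivative f := by
      conv_rhs => rw [← hfstar]
      rw [star_def, star_def, derivative_map]
    have hg' : star (derivative g) = derivative g := by
      conv_rhs => rw [← hgstar]
      rw [star_def, star_def, derivative_map]
    have e1 := Complex.conj_eq_iff_im.mp (hfix hf')
    have e2 := Complex.conj_eq_iff_im.mp (hfix hg')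
    have e3 := Complex.conj_eq_iff_im.mp (hfix hgstar)
    simp only [hqdef, derivative_add, derivative_mul, derivative_C, eval_add, eval_mul, eval_C,
      hz, zero_mul, zero_add, RCLike.star_def, Complex.mul_im, Complex.mul_re, Complex.add_re,
      Complex.add_im, Complex.conj_re, Complex.conj_im, Complex.I_re, Complex.I_im, e1, e2, e3] at h1
    rw [Complex.pos_iff, Complex.mul_re, Complex.mul_im, e1, e3]
    constructor
    · linarith
    · ring
  have hnodup : f.roots.Nodup := by
    rw [Multiset.nodup_iff_count_le_one]
    intro z
    rw [count_roots]
    by_contra! h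
    obtain ⟨h1, h2⟩ := (one_lt_rootMultiplicity_iff_isRoot hf.ne_zero).mp h
    have := hpos z h1
    rw [h2.eq_zero, zero_mul] at this
    exact this.false
  have hcard : f.roots.toFinset.card = n + 1 := by
    rw [Multiset.toFinset_card_of_nodup hnodup, ← hdeg]
    exact splits_iff_card_roots.mp (IsAlgClosed.splits f)
  set e := f.roots.toFinset.equivFinOfCardEq hcard
  set y : Fin (n + 1) → ℂ := fun a => (e.symm a : ℂ) with hydef
  have hy (a : Fin (n + 1)) : f.eval (y a) = 0 := by
    have := (e.symm a).2
    rw [Multiset.mem_toFinset, mem_roots hf.ne_zero] at this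
    exact this
  have hinj : Function.Injective y := Subtype.val_injective.comp e.symm.injective
  have hV : star (vandermonde y)ᵀ = vandermonde y := by
    rw [star_eq_conjTranspose]
    ext a i
    rw [conjTranspose_apply, transpose_apply, vandermonde_apply, star_pow]
    congr 1
    rw [← hreal _ (hy a)]
    simp
  have hunit : IsUnit (vandermonde y)ᵀ := by
    rw [isUnit_iff_isUnit_det, det_transpose, isUnit_iff_ne_zero]
    exact det_vandermonde_ne_zero_iff.mpr hinj
  rw [← hunit.posDef_star_left_conjugate_iff, hV, vandermonde_mul_bezout_mul hf hdeg hy hinj]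
  exact PosDef.diagonal fun a => hpos _ (hy a)

/-! ### Similarity over polynomial rings -/

section Similarity

variable {R : Type*} [CommRing R] {ι : Type*} [Fintype ι] [DecidableEq ι]

theorem charpoly_comp_neg_X (M : Matrix ι ι R) :
    M.charpoly.comp (-X) = (-1) ^ Fintype.card ι * (-M).charpoly := by
  have h : M.charpoly.comp (-X) = (M.charmatrix.map (compRingHom (-X))).det := by
    have := (RingHom.map_det (compRingHom (-X : R[X])) M.charmatrix)
    exact this
  rw [h, charpoly, ← det_neg]
  congr 1
  ext i j : 1
  rcases eq_or_ne i j with rfl | hij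
  · simp [charmatrix_apply_eq]
    ring
  · simp [charmatrix_apply_ne _ _ _ hij]

theorem charpoly_sq_comp (M : Matrix ι ι R) :
    (M * M).charpoly.comp (X ^ 2) = M.charpoly * (-M).charpoly := by
  have h : (M * M).charpoly.comp (X ^ 2) =
      ((M * M).charmatrix.map (compRingHom (X ^ 2))).det :=
    RingHom.map_det (compRingHom (X ^ 2 : R[X])) (M * M).charmatrix
  rw [h, charpoly, charpoly, ← det_mul]
  congr 1
  have h1 : (M * M).charmatrix.map (compRingHom (X ^ 2 : R[X])) =
      scalar ι (X ^ 2 : R[X]) - C.mapMatrix (M * M) := by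
    rw [charmatrix, RingHom.mapMatrix_apply]
    generalize M * M = N
    ext i j : 1
    rcases eq_or_ne i j with rfl | hij
    · simp
    · simp [hij]
  have h2 : Commute (scalar ι (X : R[X])) (C.mapMatrix M) :=
    scalar_commute _ (fun _ => Commute.all _ _) _
  rw [h1, charmatrix, charmatrix, map_neg, sub_neg_eq_add, ← h2.mul_self_sub_mul_self_eq',
    map_mul, sq, map_mul]

/-- The trace of the square of a matrix is determined by its characteristic polynomial. -/
theorem trace_sq_eq_of_charpoly_eq [IsDomain R] {M N : Matrix ι ι R}
    (h : M.charpoly = N.charpoly) : (M * M).trace = (N * N).trace := by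
  rcases isEmpty_or_nonempty ι with hι | hι
  · simp [trace]
  have hneg : (-M).charpoly = (-N).charpoly := by
    have h1 := charpoly_comp_neg_X M
    rw [h, charpoly_comp_neg_X N] at h1
    exact (mul_left_cancel₀ (pow_ne_zero _ (neg_ne_zero.mpr one_ne_zero)) h1).symm
  have hsq : (M * M).charpoly = (N * N).charpoly := by
    have h1 : (M * M).charpoly.comp (X ^ 2) = (N * N).charpoly.comp (X ^ 2) := by
      rw [charpoly_sq_comp, charpoly_sq_comp, h, hneg]
    rw [← expand_eq_comp_X_pow, ← expand_eq_comp_X_pow] at h1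
    exact expand_injective two_pos h1
  rw [trace_eq_neg_charpoly_coeff, trace_eq_neg_charpoly_coeff, hsq]

theorem mul_left_cancel_of_det_ne_zero [IsDomain R] {S A B : Matrix ι ι R} (hS : S.det ≠ 0)
    (h : S * A = S * B) : A = B := by
  have h1 := congrArg (S.adjugate * ·) h
  simp only [← Matrix.mul_assoc, adjugate_mul, smul_mul, Matrix.one_mul] at h1
  exact smul_right_injective _ hS h1

theorem mul_right_cancel_of_det_ne_zero [IsDomain R] {S A B : Matrix ι ι R} (hS : S.det ≠ 0)
    (h : A * S = B * S) : A = B := by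
  have h1 := congrArg (· * S.adjugate) h
  simp only [Matrix.mul_assoc, mul_adjugate, Matrix.mul_smul, Matrix.mul_one] at h1
  exact smul_right_injective _ hS h1

theorem charpoly_eq_of_mul_eq_mul [IsDomain R] {S D Y : Matrix ι ι R} (hS : S.det ≠ 0)
    (h : S * D = Y * S) : D.charpoly = Y.charpoly := by
  have h1 : C.mapMatrix S * D.charmatrix = Y.charmatrix * C.mapMatrix S := by
    have h2 : Commute (scalar ι (X : R[X])) (C.mapMatrix S) :=
      scalar_commute _ (fun _ => Commute.all _ _) _
    rw [charmatrix, charmatrix, Matrix.mul_sub, Matrix.sub_mul, h2.eq, ← map_mul, h, map_mul]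
  have h2 := congrArg det h1
  rw [det_mul, det_mul, mul_comm, ← RingHom.map_det] at h2
  exact mul_right_cancel₀ (C_ne_zero.mpr hS) h2

end Similarity

theorem exists_hermitian_conjugate {ι : Type*} [Fintype ι] [DecidableEq ι]
    {S D : Matrix ι ι ℂ[X]} (hS : ∀ z : ℂ, 0 ≤ z.im → S.det.eval z ≠ 0)
    (hD : Sᴴ * S * D = Dᴴ * (Sᴴ * S)) : ∃ Y, S * D = Y * S ∧ Yᴴ = Y := by
  have hdet : S.det ≠ 0 := by
    intro h
    exact hS 0 le_rfl (by simp [h])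
  have hdet' : Sᴴ.det ≠ 0 := by
    rw [det_conjTranspose]
    exact star_ne_zero.mpr hdet
  have hcop : IsCoprime S.det Sᴴ.det := by
    rw [det_conjTranspose, Polynomial.isCoprime_iff_aeval_ne_zero_of_isAlgClosed ℂ ℂ]
    intro z
    simp only [coe_aeval_eq_eval]
    rcases le_total 0 z.im with h | h
    · exact Or.inl (hS z h)
    · right
      rw [eval_star]
      exact star_ne_zero.mpr (hS _ (by simpa using h))
  have key : Sᴴ.det • (S * D * S.adjugate) = S.det • (Sᴴ.adjugate * Dᴴ * Sᴴ) := by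
    calc Sᴴ.det • (S * D * S.adjugate) = Sᴴ.adjugate * (Sᴴ * S * D) * S.adjugate := by
          rw [← Matrix.one_mul (S * D * S.adjugate), ← smul_mul, ← adjugate_mul]
          simp only [Matrix.mul_assoc]
      _ = Sᴴ.adjugate * Dᴴ * Sᴴ * (S * S.adjugate) := by
          rw [hD]
          simp only [Matrix.mul_assoc]
      _ = S.det • (Sᴴ.adjugate * Dᴴ * Sᴴ) := by
          rw [mul_adjugate, Matrix.mul_smul, Matrix.mul_one]
  have hdvd (i j : ι) : S.det ∣ (S * D * S.adjugate) i j := by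
    refine hcop.dvd_of_dvd_mul_left ⟨(Sᴴ.adjugate * Dᴴ * Sᴴ) i j, ?_⟩
    have := congrFun (congrFun key i) j
    simpa only [Matrix.smul_apply, smul_eq_mul] using this
  choose Y hY using hdvd
  have hY' : S * D * S.adjugate = S.det • of Y := by
    refine Matrix.ext fun i j => ?_
    simpa using hY i j
  have hSD : S * D = of Y * S := by
    apply smul_right_injective _ hdet
    change S.det • (S * D) = S.det • (of Y * S)
    rw [← smul_mul (S.det) (of Y), ← hY', Matrix.mul_assoc, adjugate_mul, Matrix.mul_smul, Matrix.mul_one]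
  refine ⟨of Y, hSD, ?_⟩
  apply mul_right_cancel_of_det_ne_zero hdet
  apply mul_left_cancel_of_det_ne_zero hdet'
  rw [← hSD, ← Matrix.mul_assoc, ← Matrix.mul_assoc, hD, ← conjTranspose_mul, ← hSD,
    conjTranspose_mul, Matrix.mul_assoc]

/-! ### Determinantal representation of strictly stable monic polynomials -/

theorem natDegree_trace_companion_sq {n : ℕ} {f : ℂ[X][X]}
    (hk : ∀ k, k ≤ n → (f.coeff k).natDegree ≤ n + 1 - k) :
    (companion n f * companion n f).trace.natDegree ≤ 2 := by
  have hentry (i j : Fin (n + 1)) :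
      companion n f i j = 0 ∨ (companion n f i j).natDegree + j ≤ i + 1 := by
    induction i using Fin.lastCases with
    | last =>
      right
      rw [companion_last, natDegree_neg, Fin.val_last]
      have := hk j (by omega)
      omega
    | cast i =>
      rw [companion_castSucc]
      split_ifs with h
      · right
        simp [h]
      · exact Or.inl rfl
  refine natDegree_sum_le_of_forall_le _ _ fun i _ => ?_
  rw [diag_apply, mul_apply]
  refine natDegree_sum_le_of_forall_le _ _ fun j _ => ?_
  rcases hentry i j with h | h
  · simp [h]
  rcases hentry j i with h' | h'
  · simp [h']
  exact natDegree_mul_le.trans (by omega)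

theorem exists_linear_of_natDegree_le_one {ι : Type*} [Fintype ι] [DecidableEq ι]
    {Y : Matrix ι ι ℂ[X]} (hY : Yᴴ = Y) (hdeg : ∀ i j, (Y i j).natDegree ≤ 1) :
    ∃ Y₀ Y₁ : Matrix ι ι ℂ, Y₀ᴴ = Y₀ ∧ Y₁ᴴ = Y₁ ∧ ∀ z, evalMat z Y = Y₀ + z • Y₁ := by
  have hherm (k : ℕ) : (Y.map fun p => p.coeff k)ᴴ = Y.map fun p => p.coeff k := by
    ext i j
    conv_rhs => rw [← hY]
    simp [coeff_star]
  refine ⟨_, _, hherm 0, hherm 1, fun z => ?_⟩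
  ext i j
  rw [evalMat_apply, eval_eq_sum_range' (Nat.lt_succ_of_le (hdeg i j))]
  simp [Finset.sum_range_succ]
  ring

theorem exists_representation_of_real_imaginary {n : ℕ} {f g : ℂ[X][X]} (hf : f.Monic)
    (hdeg : f.natDegree = n + 1) (hgdeg : g.natDegree ≤ n)
    (hfstar : ∀ k, star (f.coeff k) = f.coeff k) (hgstar : ∀ k, star (g.coeff k) = g.coeff k)
    (hfk : ∀ k, k ≤ n → (f.coeff k).natDegree ≤ n + 1 - k) (hgn : (g.coeff n).natDegree ≤ 1)
    (hroots : ∀ x : ℝ, ∀ y : ℂ,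
      ((f + C (C Complex.I) * g).map (evalRingHom (x : ℂ))).eval y = 0 → y.im < 0) :
    ∃ A B : Matrix (Fin (n + 1)) (Fin (n + 1)) ℂ,
      ((2 * Complex.I)⁻¹ • (A - Aᴴ)).PosSemidef ∧ Bᴴ = B ∧
      ∀ z, (f + C (C Complex.I) * g).map (evalRingHom z) = (-(A + z • B)).charpoly := by
  set D := companion n f with hD
  set G := bezout n f g with hG
  have hmapstar {h : ℂ[X][X]} (hh : ∀ k, star (h.coeff k) = h.coeff k) (x : ℝ) :
      star (h.map (evalRingHom (x : ℂ))) = h.map (evalRingHom (x : ℂ)) := by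
    ext k
    rw [coeff_star, coeff_map, coe_evalRingHom, ← eval_star_real, hh]
  have hpos (x : ℝ) : (evalMat (x : ℂ) G).PosDef := by
    have h : evalMat (x : ℂ) G = G.map (evalRingHom (x : ℂ)) := rfl
    rw [h, hG, bezout_map]
    refine bezout_posDef (hf.map _) ((hf.natDegree_map _).trans hdeg)
      (natDegree_map_le.trans hgdeg) (hmapstar hfstar x) (hmapstar hgstar x) fun z hz => ?_
    refine hroots x z ?_
    simpa using hz
  obtain ⟨S, hGS, hS⟩ := exists_spectral_factor hpos
  have hdet : S.det ≠ 0 := by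
    intro h
    exact hS 0 le_rfl (by simp [h])
  have hDstar : Dᴴ = Dᵀ := by
    ext i j : 1
    rw [conjTranspose_apply, transpose_apply]
    induction j using Fin.lastCases with
    | last => rw [hD, companion_last, star_neg, hfstar]
    | cast j =>
      rw [hD, companion_castSucc]
      split_ifs <;> simp
  obtain ⟨Y, hSD, hY⟩ := exists_hermitian_conjugate (D := D) hS (by
    rw [← hGS, hDstar]
    exact bezout_mul_companion hf hdeg g)
  have hYdeg (i j : Fin (n + 1)) : (Y i j).natDegree ≤ 1 := by
    have h1 : (∑ k : Fin (n + 1) × Fin (n + 1), Y k.1 k.2 * star (Y k.1 k.2)).natDegree ≤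
        2 * 1 := by
      have h2 : ∑ k : Fin (n + 1) × Fin (n + 1), Y k.1 k.2 * star (Y k.1 k.2) =
          (Y * Y).trace := by
        rw [Fintype.sum_prod_type, trace]
        refine Finset.sum_congr rfl fun i _ => ?_
        rw [diag_apply, mul_apply]
        refine Finset.sum_congr rfl fun j _ => ?_
        rw [← conjTranspose_apply, hY]
      rw [h2, ← trace_sq_eq_of_charpoly_eq (charpoly_eq_of_mul_eq_mul hdet hSD)]
      exact natDegree_trace_companion_sq hfk
    exact natDegree_le_of_sum_mul_star Finset.univ (fun k : Fin (n + 1) × Fin (n + 1) =>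
      Y k.1 k.2) 1 h1 (i, j) (Finset.mem_univ _)
  obtain ⟨Y₀, Y₁, hY₀, hY₁, hYlin⟩ := exists_linear_of_natDegree_le_one hY hYdeg
  have hlastG (j : Fin (n + 1)) : ∑ k, star (S k (Fin.last n)) * S k j = g.coeff j := by
    rw [← bezout_last hf hdeg hgdeg, ← hG, hGS, mul_apply]
    rfl
  have hgn0 : (g.coeff n).natDegree ≤ 0 := by
    have hlast : g.coeff n = G (Fin.last n) (Fin.last n) := by
      rw [hG, bezout_last hf hdeg hgdeg, Fin.val_last]
    have h : (g.coeff n).coeff 1 = 0 :=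
      coeff_eq_zero_of_odd_bound (n := 0) (by simpa using hgn) fun x => by
        rw [hlast]
        exact (hpos x).posSemidef.diag_nonneg
    rcases natDegree_le_pred_of_coeff_eq_zero hgn h with h | h
    · simp [h]
    · omega
  have he (k : Fin (n + 1)) : S k (Fin.last n) = C ((S k (Fin.last n)).coeff 0) := by
    refine eq_C_of_natDegree_le_zero ?_
    refine natDegree_le_of_sum_mul_star Finset.univ (fun k => S k (Fin.last n)) 0 ?_ k
      (Finset.mem_univ _)
    have := hlastG (Fin.last n)
    rw [Fin.val_last] at this
    simp only [mul_comm _ (star _)]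
    rw [this]
    simpa using hgn0
  set e : Fin (n + 1) → ℂ := fun k => (S k (Fin.last n)).coeff 0 with hedef
  set Z := Y - (vecMulVec (Complex.I • e) (star e)).map C with hZ
  have hSq : S * companion n (f + C (C Complex.I) * g) = Z * S := by
    have h1 : companion n (f + C (C Complex.I) * g) =
        D - of fun i (j : Fin (n + 1)) => if i = Fin.last n then C Complex.I * g.coeff j else 0 := by
      ext i j : 1
      induction i using Fin.lastCases with
      | last =>
        simp [companion_last, hD]
        ring
      | cast i => simp [companion_castSucc, hD, (Fin.castSucc_lt_last i).ne]
    have h2 : S * (of fun i (j : Fin (n + 1)) =>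
        if i = Fin.last n then C Complex.I * g.coeff j else 0) =
        (vecMulVec (Complex.I • e) (star e)).map C * S := by
      ext i j : 1
      rw [mul_apply, mul_apply]
      simp only [of_apply, mul_ite, mul_zero, Finset.sum_ite_eq', Finset.mem_univ, if_true]
      rw [← hlastG j, he i]
      simp only [Finset.mul_sum]
      refine Finset.sum_congr rfl fun k _ => ?_
      rw [he k, star_C]
      simp [vecMulVec_apply, hedef]
      ring
    rw [h1, Matrix.mul_sub, h2, hZ, Matrix.sub_mul, hSD]
  have hqm : (f + C (C Complex.I) * g).Monic :=
    hf.add_of_left (degree_lt_degree (lt_of_le_of_lt (natDegree_C_mul_le _ _) (by omega)))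
  have hqd : (f + C (C Complex.I) * g).natDegree = n + 1 := by
    rw [natDegree_add_eq_left_of_natDegree_lt, hdeg]
    exact lt_of_le_of_lt (natDegree_C_mul_le _ _) (by omega)
  refine ⟨-Y₀ + vecMulVec (Complex.I • e) (star e), -Y₁, ?_, by rw [conjTranspose_neg, hY₁],
    fun z => ?_⟩
  · have h : (2 * Complex.I)⁻¹ • (-Y₀ + vecMulVec (Complex.I • e) (star e) -
        (-Y₀ + vecMulVec (Complex.I • e) (star e))ᴴ) = vecMulVec e (star e) := by
      rw [conjTranspose_add, conjTranspose_neg, hY₀, conjTranspose_vecMulVec]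
      ext i j
      simp [vecMulVec_apply]
      field_simp
      linear_combination (-2 * e i * (starRingEnd ℂ) (e j)) * Complex.I_sq
    rw [h]
    exact posSemidef_vecMulVec_self_star e
  · have h1 := charpoly_companion hqm hqd
    rw [charpoly_eq_of_mul_eq_mul hdet hSq] at h1
    rw [← h1, ← charpoly_map]
    congr 1
    have h2 : Z.map (evalRingHom z) = evalMat z Y - vecMulVec (Complex.I • e) (star e) := by
      ext i j
      simp [hZ]
    rw [h2, hYlin]
    rw [smul_neg]
    abel

theorem exists_representation_of_roots_im_neg {n : ℕ} {q : ℂ[X][X]} (hq : q.Monic)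
    (hdeg : q.natDegree = n + 1) (hk : ∀ k, (q.coeff k).natDegree ≤ n + 1 - k)
    (hroots : ∀ x : ℝ, ∀ y : ℂ, (q.map (evalRingHom (x : ℂ))).eval y = 0 → y.im < 0) :
    ∃ A B : Matrix (Fin (n + 1)) (Fin (n + 1)) ℂ,
      ((2 * Complex.I)⁻¹ • (A - Aᴴ)).PosSemidef ∧ Bᴴ = B ∧
      ∀ z, q.map (evalRingHom z) = (-(A + z • B)).charpoly := by
  set f : ℂ[X][X] := C (C (1 / 2)) * (q + q.map (starRingEnd ℂ[X])) with hf
  set g : ℂ[X][X] := C (C (-Complex.I / 2)) * (q - q.map (starRingEnd ℂ[X])) with hg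
  have hfc (k : ℕ) : f.coeff k = C (1 / 2) * (q.coeff k + star (q.coeff k)) := by
    simp [hf, starRingEnd_apply]
  have hgc (k : ℕ) : g.coeff k = C (-Complex.I / 2) * (q.coeff k - star (q.coeff k)) := by
    simp [hg, starRingEnd_apply]
  have hqlead : q.coeff (n + 1) = 1 := by
    rw [← hdeg]
    exact hq
  have hlead : f.coeff (n + 1) = 1 := by
    rw [hfc, hqlead, star_one, ← C_1, ← C_add, ← C_mul]
    norm_num
  have hfd : f.natDegree ≤ n + 1 := by
    rw [natDegree_le_iff_coeff_eq_zero]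
    intro k hk
    rw [hfc, coeff_eq_zero_of_natDegree_lt (hdeg.trans_lt hk)]
    simp
  have hfm : f.Monic := monic_of_natDegree_le_of_coeff_eq_one _ hfd hlead
  have hfd' : f.natDegree = n + 1 :=
    natDegree_eq_of_le_of_coeff_ne_zero hfd (by rw [hlead]; exact one_ne_zero)
  have hgd : g.natDegree ≤ n := by
    rw [natDegree_le_iff_coeff_eq_zero]
    intro k hk
    rcases eq_or_lt_of_le (Nat.succ_le_of_lt hk) with h | h
    · rw [hgc, ← h, Nat.succ_eq_add_one, hqlead]
      simp
    · rw [hgc, coeff_eq_zero_of_natDegree_lt (hdeg.trans_lt h)]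
      simp
  have hqfg : q = f + C (C Complex.I) * g := by
    ext k : 1
    rw [coeff_add, coeff_C_mul (p := g), hfc, hgc, ← mul_assoc, ← C_mul]
    have h : Complex.I * (-Complex.I / 2) = 1 / 2 := by
      linear_combination (-1 / 2 : ℂ) * Complex.I_mul_I
    have h2 : (C (1 / 2) : ℂ[X]) * 2 = 1 := by
      rw [← C_ofNat, ← C_mul]
      norm_num
    rw [h]
    linear_combination (-q.coeff k) * h2
  rw [hqfg] at hroots ⊢
  refine exists_representation_of_real_imaginary hfm hfd' hgd (fun k => ?_) (fun k => ?_)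
    (fun k _ => ?_) ?_ hroots
  · rw [hfc, star_mul', star_C, star_add, star_star, add_comm (star _)]
    simp
  · rw [hgc, star_mul', star_C, star_sub, star_star, ← neg_sub (q.coeff k), mul_neg, ← neg_mul,
      ← C_neg]
    congr 2
    simp
    ring
  · rw [hfc]
    refine (natDegree_C_mul_le _ _).trans (natDegree_add_le_of_degree_le (hk k) ?_)
    rw [natDegree_star]
    exact hk k
  · rw [hgc]
    have := hk n
    refine (natDegree_C_mul_le _ _).trans (natDegree_sub_le_of_le (n := 1) (m := 1) ?_ ?_ |>.trans
      (by simp))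
    · omega
    · rw [natDegree_star]
      omega

/-! ### Compactness -/

section Compactness

variable {ι : Type*}

/-- The imaginary part of a square matrix. -/
noncomputable def imPart (M : Matrix ι ι ℂ) : Matrix ι ι ℂ := (2 * Complex.I)⁻¹ • (M - Mᴴ)

theorem imPart_isHermitian (M : Matrix ι ι ℂ) : (imPart M).IsHermitian := by
  ext i j
  simp only [imPart, conjTranspose_apply, Matrix.smul_apply, Matrix.sub_apply, smul_eq_mul]
  simp
  ring

theorem imPart_add_of_isHermitian (M : Matrix ι ι ℂ) {B : Matrix ι ι ℂ} (hB : Bᴴ = B) :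
    imPart (M + B) = imPart M := by
  rw [imPart, imPart, conjTranspose_add, hB, add_sub_add_right_eq_sub]

theorem continuous_imPart : Continuous (imPart : Matrix ι ι ℂ → Matrix ι ι ℂ) := by
  unfold imPart
  exact (continuous_const_smul _).comp (continuous_id.sub continuous_id.matrix_conjTranspose)

variable [Fintype ι]

theorem norm_entry_le_trace {P : Matrix ι ι ℂ} (hP : P.PosSemidef) (i j : ι) :
    ‖P i j‖ ≤ P.trace.re := by
  classical
  open scoped MatrixOrder in
  obtain ⟨B, rfl⟩ := CStarAlgebra.nonneg_iff_eq_star_mul_self.mp hP.nonneg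
  have hdiag (k : ι) : ((star B * B) k k).re = ∑ l, ‖B l k‖ ^ 2 := by
    rw [mul_apply, Complex.re_sum]
    refine Finset.sum_congr rfl fun l _ => ?_
    rw [star_eq_conjTranspose, conjTranspose_apply, RCLike.star_def, mul_comm, Complex.mul_conj,
      Complex.ofReal_re, Complex.normSq_eq_norm_sq]
  have htrace (k : ι) : ((star B * B) k k).re ≤ (star B * B).trace.re := by
    rw [trace, Complex.re_sum]
    refine Finset.single_le_sum (f := fun k => ((star B * B).diag k).re) (fun l _ => ?_)
      (Finset.mem_univ k)
    rw [diag_apply, hdiag]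
    positivity
  have hij : ‖(star B * B) i j‖ ≤ ∑ l, ‖B l i‖ * ‖B l j‖ := by
    rw [mul_apply]
    refine (norm_sum_le _ _).trans (Finset.sum_le_sum fun l _ => ?_)
    rw [norm_mul, star_eq_conjTranspose, conjTranspose_apply, norm_star]
  have hamgm : 2 * ∑ l, ‖B l i‖ * ‖B l j‖ ≤ ∑ l, ‖B l i‖ ^ 2 + ∑ l, ‖B l j‖ ^ 2 := by
    rw [Finset.mul_sum, ← Finset.sum_add_distrib]
    refine Finset.sum_le_sum fun l _ => ?_
    nlinarith [sq_nonneg (‖B l i‖ - ‖B l j‖)]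
  rw [← hdiag, ← hdiag] at hamgm
  linarith [htrace i, htrace j]

variable [DecidableEq ι]

theorem exists_entry_bound (P : ℂ[X]) : ∃ R : ℝ, ∀ M : Matrix ι ι ℂ, (-M).charpoly = P →
    (imPart M + 1).PosSemidef → ∀ i j, ‖M i j‖ ≤ R := by
  by_cases hne : ∃ M : Matrix ι ι ℂ, (-M).charpoly = P
  swap
  · push Not at hne
    exact ⟨0, fun M hM => absurd hM (hne M)⟩
  obtain ⟨M₀, hM₀⟩ := hne
  set κ : ℝ := |M₀.trace.im| + Fintype.card ι + 1
  have hκ : 0 ≤ κ := by positivity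
  set E : ℝ := ‖(M₀ * M₀).trace‖ + ∑ _ij : ι × ι, κ ^ 2
  refine ⟨κ + E + 1, fun M hM hpos i j => ?_⟩
  have htr : M.trace = M₀.trace := by
    have : Nonempty ι := ⟨i⟩
    rw [← neg_inj, ← trace_neg, ← trace_neg, trace_eq_neg_charpoly_coeff,
      trace_eq_neg_charpoly_coeff, hM, hM₀]
  have htr2 : (M * M).trace = (M₀ * M₀).trace := by
    have := trace_sq_eq_of_charpoly_eq (hM.trans hM₀.symm)
    simpa using this
  have htrP : (imPart M + 1).trace.re = M₀.trace.im + Fintype.card ι := by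
    rw [trace_add, trace_one, imPart, trace_smul, trace_sub, trace_conjTranspose, htr,
      RCLike.star_def, Complex.sub_conj]
    have : (2 * Complex.I)⁻¹ * ((2 * M₀.trace.im : ℝ) * Complex.I) = M₀.trace.im := by
      push_cast
      field_simp
    rw [smul_eq_mul, this]
    simp
  have hK (k l : ι) : ‖imPart M k l‖ ≤ κ := by
    have h1 := norm_entry_le_trace hpos k l
    have h2 : ‖(1 : Matrix ι ι ℂ) k l‖ ≤ 1 := by
      rw [one_apply]
      split_ifs <;> simp
    have h3 : imPart M k l = (imPart M + 1) k l - (1 : Matrix ι ι ℂ) k l := by simp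
    rw [h3]
    refine (norm_sub_le _ _).trans ?_
    linarith [le_abs_self M₀.trace.im]
  have hMK (k l : ι) : M l k = star (M k l) + 2 * Complex.I * imPart M l k := by
    simp only [imPart, Matrix.smul_apply, Matrix.sub_apply, conjTranspose_apply, smul_eq_mul]
    field_simp
    ring
  have hsum : ((∑ kl : ι × ι, ‖M kl.1 kl.2‖ ^ 2 : ℝ) : ℂ) =
      (M₀ * M₀).trace - 2 * Complex.I * ∑ kl : ι × ι, M kl.1 kl.2 * imPart M kl.2 kl.1 := by
    rw [← htr2, Finset.mul_sum, trace, Complex.ofReal_sum]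
    simp only [diag_apply, mul_apply]
    rw [← Fintype.sum_prod_type' (f := fun k l => M k l * M l k), ← Finset.sum_sub_distrib]
    refine Finset.sum_congr rfl fun kl _ => ?_
    conv_rhs => rw [hMK kl.1 kl.2]
    rw [← Complex.normSq_eq_norm_sq, ← Complex.mul_conj, RCLike.star_def]
    ring
  have hle : ∑ kl : ι × ι, ‖M kl.1 kl.2‖ ^ 2 ≤
      ‖(M₀ * M₀).trace‖ + 2 * ∑ kl : ι × ι, ‖M kl.1 kl.2‖ * κ := by
    have h1 : ‖((∑ kl : ι × ι, ‖M kl.1 kl.2‖ ^ 2 : ℝ) : ℂ)‖ =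
        ∑ kl : ι × ι, ‖M kl.1 kl.2‖ ^ 2 := by
      rw [Complex.norm_real, Real.norm_of_nonneg (by positivity)]
    rw [← h1, hsum]
    refine (norm_sub_le _ _).trans (add_le_add le_rfl ?_)
    rw [norm_mul, norm_mul, Complex.norm_I, mul_one, Complex.norm_ofNat]
    refine mul_le_mul_of_nonneg_left ?_ two_pos.le
    refine (norm_sum_le _ _).trans (Finset.sum_le_sum fun kl _ => ?_)
    rw [norm_mul]
    exact mul_le_mul_of_nonneg_left (hK _ _) (norm_nonneg _)
  have hsq : ∑ kl : ι × ι, (‖M kl.1 kl.2‖ - κ) ^ 2 ≤ E := by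
    have h1 : ∑ kl : ι × ι, (‖M kl.1 kl.2‖ - κ) ^ 2 = ∑ kl : ι × ι, ‖M kl.1 kl.2‖ ^ 2 -
        2 * ∑ kl : ι × ι, ‖M kl.1 kl.2‖ * κ + ∑ _ij : ι × ι, κ ^ 2 := by
      rw [Finset.mul_sum, ← Finset.sum_sub_distrib, ← Finset.sum_add_distrib]
      exact Finset.sum_congr rfl fun kl _ => by ring
    rw [h1]
    linarith
  have hij : (‖M i j‖ - κ) ^ 2 ≤ E :=
    (Finset.single_le_sum (f := fun kl : ι × ι => (‖M kl.1 kl.2‖ - κ) ^ 2)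
      (fun kl _ => sq_nonneg _) (Finset.mem_univ (i, j))).trans hsq
  nlinarith [sq_nonneg (‖M i j‖ - κ - 1 / 2)]

/-- Determinantal representations of a fixed family of polynomials with almost nonnegative
imaginary part converge, along a subsequence, to one with nonnegative imaginary part. -/
theorem exists_limit_representation (Q : ℂ → ℂ[X])
    (h : ∀ ε : ℝ, 0 < ε → ∃ A B : Matrix ι ι ℂ, (imPart A + (ε : ℂ) • 1).PosSemidef ∧ Bᴴ = B ∧
      ∀ z, (-(A + z • B)).charpoly = Q z) :
    ∃ A B : Matrix ι ι ℂ, (imPart A).PosSemidef ∧ Bᴴ = B ∧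
      ∀ z, (-(A + z • B)).charpoly = Q z := by
  choose! A B hA hB hAB using h
  set ε : ℕ → ℝ := fun m => 1 / ((m : ℝ) + 1) with hεdef
  have hε (m : ℕ) : 0 < ε m := Nat.one_div_pos_of_nat
  have hε1 (m : ℕ) : ε m ≤ 1 := by
    rw [hεdef]
    exact (div_le_one (by positivity)).mpr (by simp)
  have hA1 (m : ℕ) : (imPart (A (ε m)) + 1).PosSemidef := by
    have h1 : imPart (A (ε m)) + 1 =
        imPart (A (ε m)) + (ε m : ℂ) • 1 + ((1 - ε m : ℝ) : ℂ) • (1 : Matrix ι ι ℂ) := by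
      rw [add_assoc, ← add_smul]
      simp
    rw [h1]
    refine (hA _ (hε m)).add (PosSemidef.one.smul ?_)
    exact Complex.zero_le_real.mpr (sub_nonneg.mpr (hε1 m))
  obtain ⟨R₀, hR₀⟩ := exists_entry_bound (ι := ι) (Q 0)
  obtain ⟨R₁, hR₁⟩ := exists_entry_bound (ι := ι) (Q 1)
  have hbA (m : ℕ) (i j : ι) : ‖A (ε m) i j‖ ≤ R₀ :=
    hR₀ _ (by simpa using hAB _ (hε m) 0) (hA1 m) i j
  have hbB (m : ℕ) (i j : ι) : ‖B (ε m) i j‖ ≤ R₁ + R₀ := by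
    have h1 := hR₁ (A (ε m) + B (ε m)) (by simpa using hAB _ (hε m) 1)
      (by rw [imPart_add_of_isHermitian _ (hB _ (hε m))]; exact hA1 m) i j
    have h2 : B (ε m) i j = (A (ε m) + B (ε m)) i j - A (ε m) i j := by simp
    rw [h2]
    exact (norm_sub_le _ _).trans (add_le_add h1 (hbA m i j))
  have hcpt (R : ℝ) : IsCompact (Set.pi Set.univ fun _ : ι =>
      Set.pi Set.univ fun _ : ι => Metric.closedBall (0 : ℂ) R) :=
    isCompact_univ_pi fun _ => isCompact_univ_pi fun _ => isCompact_closedBall 0 R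
  obtain ⟨⟨A', B'⟩, -, φ, hφ, hlim⟩ := ((hcpt R₀).prod (hcpt (R₁ + R₀))).tendsto_subseq
    (X := (ι → ι → ℂ) × (ι → ι → ℂ)) (x := fun m => (A (ε m), B (ε m))) fun m =>
      ⟨fun i _ j _ => by simpa using hbA m i j, fun i _ j _ => by simpa using hbB m i j⟩
  have hlimA : Filter.Tendsto (fun m => A (ε (φ m))) Filter.atTop (nhds (of A')) :=
    (continuous_fst.tendsto _).comp hlim
  have hlimB : Filter.Tendsto (fun m => B (ε (φ m))) Filter.atTop (nhds (of B')) :=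
    (continuous_snd.tendsto _).comp hlim
  have hlimε : Filter.Tendsto (fun m => (ε (φ m) : ℂ)) Filter.atTop (nhds 0) := by
    rw [← Complex.ofReal_zero]
    exact (Complex.continuous_ofReal.tendsto 0).comp
      (tendsto_one_div_add_atTop_nhds_zero_nat.comp hφ.tendsto_atTop)
  refine ⟨of A', of B', ?_, ?_, fun z => ?_⟩
  · refine PosSemidef.of_dotProduct_mulVec_nonneg (imPart_isHermitian _) fun x => ?_
    have hcont : Continuous fun u : Matrix ι ι ℂ × ℂ =>
        star x ⬝ᵥ ((imPart u.1 + u.2 • (1 : Matrix ι ι ℂ)) *ᵥ x) :=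
      Continuous.dotProduct continuous_const
        (((continuous_imPart.comp continuous_fst).add
          (continuous_snd.smul continuous_const)).matrix_mulVec continuous_const)
    have h1 := (hcont.tendsto (of A', 0)).comp (hlimA.prodMk_nhds hlimε)
    rw [zero_smul, add_zero] at h1
    exact ge_of_tendsto' h1 fun m => (hA _ (hε (φ m))).dotProduct_mulVec_nonneg x
  · have h1 : Filter.Tendsto (fun m => (B (ε (φ m)))ᴴ) Filter.atTop (nhds (of B')ᴴ) :=
      (continuous_id.matrix_conjTranspose.tendsto _).comp hlimB
    refine tendsto_nhds_unique (h1.congr fun m => ?_) hlimB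
    exact hB _ (hε (φ m))
  · refine Polynomial.funext fun y => ?_
    rw [eval_charpoly]
    have hcont : Continuous fun u : Matrix ι ι ℂ × Matrix ι ι ℂ =>
        (scalar ι y - -(u.1 + z • u.2)).det :=
      (continuous_const.sub (continuous_fst.add (continuous_snd.const_smul z)).neg).matrix_det
    refine tendsto_nhds_unique ((hcont.tendsto (of A', of B')).comp (hlimA.prodMk_nhds hlimB)) ?_
    refine tendsto_const_nhds.congr fun m => ?_
    rw [← hAB _ (hε (φ m)) z, eval_charpoly]
    rfl

end Compactness

/-! ### Restriction to lines and the leading form -/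

section Line

variable {σ : Type*} {p : MvPolynomial σ ℂ}

/-- The restriction of a polynomial to the complex line `s ↦ u + s v`. -/
noncomputable def restrictLine (p : MvPolynomial σ ℂ) (u v : σ → ℂ) : ℂ[X] :=
  MvPolynomial.aeval (fun i => C (u i) + C (v i) * X) p

theorem eval_restrictLine (p : MvPolynomial σ ℂ) (u v : σ → ℂ) (s : ℂ) :
    (restrictLine p u v).eval s = MvPolynomial.eval (fun i => u i + v i * s) p := by
  rw [restrictLine, MvPolynomial.aeval_def, ← coe_evalRingHom, MvPolynomial.hom_eval₂,
    MvPolynomial.eval, MvPolynomial.coe_eval₂Hom]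
  congr 1
  · ext; simp
  · ext; simp

theorem natDegree_restrictLine_le (p : MvPolynomial σ ℂ) (u v : σ → ℂ) :
    (restrictLine p u v).natDegree ≤ p.totalDegree := by
  rw [← mul_one p.totalDegree]
  refine MvPolynomial.aeval_natDegree_le p le_rfl _ fun i => ?_
  rw [add_comm]
  exact natDegree_linear_le

theorem coeff_restrictLine_zero (p : MvPolynomial σ ℂ) (v : σ → ℂ) (d : ℕ) :
    (restrictLine p 0 v).coeff d =
      MvPolynomial.eval v (MvPolynomial.homogeneousComponent d p) := by
  induction p using MvPolynomial.induction_on' with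
  | monomial s a =>
    have h1 : restrictLine (MvPolynomial.monomial s a) 0 v =
        C (MvPolynomial.eval v (MvPolynomial.monomial s a)) * X ^ s.degree := by
      refine Polynomial.funext fun t => ?_
      rw [eval_restrictLine]
      simp [MvPolynomial.eval_monomial, Finsupp.prod, mul_pow, Finset.prod_mul_distrib,
        Finset.prod_pow_eq_pow_sum, Finsupp.degree_apply, mul_assoc, eval_prod]
    rw [h1, coeff_C_mul_X_pow, MvPolynomial.homogeneousComponent_of_mem
      (MvPolynomial.isHomogeneous_monomial a rfl)]
    split_ifs <;> simp
  | add p q hp hq =>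
    rw [map_add, map_add, ← hp, ← hq, ← coeff_add]
    simp [restrictLine]

theorem exists_coeff_restrictLine_ne_zero (hp : p ≠ 0) :
    ∃ v, (restrictLine p 0 v).coeff p.totalDegree ≠ 0 := by
  by_contra! h
  have h0 : MvPolynomial.homogeneousComponent p.totalDegree p = 0 := by
    refine MvPolynomial.funext fun v => ?_
    rw [← coeff_restrictLine_zero, h, map_zero]
  obtain ⟨s, hs, hs'⟩ := Finset.exists_mem_eq_sup p.support
    (MvPolynomial.support_nonempty.mpr hp) fun s => s.sum fun _ e => e
  have h1 := MvPolynomial.coeff_homogeneousComponent p.totalDegree p s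
  have hs'' : s.degree = p.totalDegree := hs'.symm
  rw [h0, if_pos hs'', MvPolynomial.coeff_zero] at h1
  exact MvPolynomial.mem_support_iff.mp hs h1.symm

theorem norm_coeff_le_of_norm_eval_le {a b : ℂ[X]} {d : ℕ} {K : ℝ} (ha : a.natDegree ≤ d)
    (hb : b.natDegree ≤ d) (h : ∀ T : ℝ, 0 < T → ‖a.eval (T : ℂ)‖ ≤ K * ‖b.eval (T : ℂ)‖) :
    ‖a.coeff d‖ ≤ K * ‖b.coeff d‖ := by
  have hzero (r : ℂ[X]) : r.coeff d = (reflect d r).eval 0 := by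
    rw [← coeff_zero_eq_eval_zero, coeff_reflect, revAt_zero]
  have hlim (r : ℂ[X]) : Filter.Tendsto (fun T : ℝ => ‖(reflect d r).eval (T : ℂ)‖)
      (nhdsWithin 0 (Set.Ioi 0)) (nhds ‖r.coeff d‖) := by
    rw [hzero]
    have hc : Continuous fun T : ℝ => ‖(reflect d r).eval (T : ℂ)‖ :=
      ((reflect d r).continuous.comp Complex.continuous_ofReal).norm
    simpa using (hc.tendsto 0).mono_left nhdsWithin_le_nhds
  refine le_of_tendsto_of_tendsto (hlim a) ((hlim b).const_mul K) ?_
  filter_upwards [self_mem_nhdsWithin] with T hT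
  have hT' : (0 : ℝ) < T := hT
  have hrefl {r : ℂ[X]} (hr : r.natDegree ≤ d) :
      ‖r.eval ((T⁻¹ : ℝ) : ℂ)‖ = ‖(reflect d r).eval (T : ℂ)‖ * (T⁻¹) ^ d := by
    have hT0 : ((T⁻¹ : ℝ) : ℂ) ≠ 0 := by exact_mod_cast (inv_pos.mpr hT').ne'
    let _ := invertibleOfNonzero hT0
    have h1 := eval₂_reflect_mul_pow (RingHom.id ℂ) ((T⁻¹ : ℝ) : ℂ) d r hr
    rw [invOf_eq_inv, ← Complex.ofReal_inv, inv_inv] at h1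
    rw [eval, ← h1, norm_mul, norm_pow, Complex.norm_real, Real.norm_eq_abs,
      abs_of_pos (inv_pos.mpr hT')]
    rfl
  have h1 := h T⁻¹ (inv_pos.mpr hT')
  rw [hrefl ha, hrefl hb, ← mul_assoc] at h1
  exact le_of_mul_le_mul_right h1 (by positivity)

theorem norm_eval_one_le {r : ℝ} (hr : 0 < r) {d : ℕ} {u : ℂ[X]} (hd : u.natDegree ≤ d)
    (hu : ∀ s : ℂ, ‖s‖ < r → u.eval s ≠ 0) : ‖u.eval 1‖ ≤ (1 + 1 / r) ^ d * ‖u.eval 0‖ := by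
  induction d generalizing u with
  | zero =>
    rw [eq_C_of_natDegree_le_zero hd]
    simp
  | succ d ih =>
    by_cases hdeg : u.degree = 0
    · rw [eq_C_of_degree_eq_zero hdeg, eval_C, eval_C]
      refine le_mul_of_one_le_left (norm_nonneg _) (one_le_pow₀ ?_)
      exact le_add_of_nonneg_right (by positivity)
    · obtain ⟨a, ha⟩ := Complex.isAlgClosed.exists_root u hdeg
      obtain ⟨w, rfl⟩ := dvd_iff_isRoot.mpr ha
      have hw : w ≠ 0 := by
        rintro rfl
        exact hu 0 (by simpa using hr) (by simp)
      have har : r ≤ ‖a‖ := by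
        by_contra! h
        exact hu a h ha
      have hwd : w.natDegree ≤ d := by
        rw [natDegree_mul (X_sub_C_ne_zero a) hw, natDegree_X_sub_C] at hd
        omega
      have h1 := ih hwd fun s hs h => hu s hs (by rw [eval_mul, h, mul_zero])
      have h2 : ‖1 - a‖ ≤ (1 + 1 / r) * ‖a‖ := by
        have h3 : 1 ≤ 1 / r * ‖a‖ := by
          rw [one_div_mul_eq_div, one_le_div hr]
          exact har
        have h4 := norm_sub_le 1 a
        rw [norm_one] at h4
        linarith
      simp only [eval_mul, eval_sub, eval_X, eval_C, norm_mul, zero_sub, norm_neg]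
      calc ‖1 - a‖ * ‖w.eval 1‖
          ≤ ((1 + 1 / r) * ‖a‖) * ((1 + 1 / r) ^ d * ‖w.eval 0‖) := by gcongr
        _ = _ := by ring

theorem exists_pos_forall_im_pos [Finite σ] {z : σ → ℂ} (hz : ∀ i, 0 < (z i).im) (v : σ → ℂ) :
    ∃ r > 0, ∀ s : ℂ, ‖s‖ < r → ∀ i, 0 < (z i + v i * s).im := by
  have hopen : IsOpen {s : ℂ | ∀ i, 0 < (z i + v i * s).im} := by
    simp only [Set.ofPred_forall]
    exact isOpen_iInter_of_finite fun i => isOpen_lt continuous_const (by fun_prop)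
  obtain ⟨r, hr, h⟩ := Metric.isOpen_iff.mp hopen 0 (by simpa using hz)
  exact ⟨r, hr, fun s hs => h (by simpa using hs)⟩

/-- The leading form of a stable polynomial is stable. -/
theorem coeff_restrictLine_ne_zero [Finite σ]
    (hp : ∀ z : σ → ℂ, (∀ i, 0 < (z i).im) → MvPolynomial.eval z p ≠ 0) {z : σ → ℂ}
    (hz : ∀ i, 0 < (z i).im) : (restrictLine p 0 z).coeff p.totalDegree ≠ 0 := by
  have hp0 : p ≠ 0 := by
    rintro rfl
    exact hp z hz (map_zero _)
  obtain ⟨w, hw⟩ := exists_coeff_restrictLine_ne_zero hp0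
  obtain ⟨r, hr, h⟩ := exists_pos_forall_im_pos hz (w - z)
  intro h0
  have h1 := norm_coeff_le_of_norm_eval_le (K := (1 + 1 / r) ^ p.totalDegree)
    (natDegree_restrictLine_le p 0 w) (natDegree_restrictLine_le p 0 z) fun T hT => ?_
  · rw [h0, norm_zero, mul_zero] at h1
    exact hw (norm_le_zero_iff.mp h1)
  · have h2 := norm_eval_one_le hr
      (natDegree_restrictLine_le p (fun i => z i * T) fun i => (w - z) i * T) fun s hs => ?_
    · simp only [eval_restrictLine] at h2 ⊢
      convert h2 using 5
      · simp; ring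
      · simp
    · rw [eval_restrictLine]
      refine hp _ fun i => ?_
      rw [show z i * T + (w - z) i * T * s = (z i + (w - z) i * s) * T by ring,
        Complex.im_mul_ofReal]
      exact mul_pos (h s hs i) hT

theorem coeff_restrictLine_smul (p : MvPolynomial σ ℂ) (a : ℂ) (v : σ → ℂ) (d : ℕ) :
    (restrictLine p 0 (a • v)).coeff d = (restrictLine p 0 v).coeff d * a ^ d := by
  rw [← comp_C_mul_X_coeff]
  congr 1
  refine Polynomial.funext fun s => ?_
  simp [eval_restrictLine, mul_assoc, mul_left_comm]

end Line

/-! ### Bivariate weights -/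

section Weight

/-- The coefficients of `r` vanish above total degree `d`. -/
def HasWeight (d : ℕ) (r : ℂ[X][X]) : Prop := ∀ k j, d < j + k → (r.coeff k).coeff j = 0

theorem HasWeight.mul {d e : ℕ} {r s : ℂ[X][X]} (hr : HasWeight d r) (hs : HasWeight e s) :
    HasWeight (d + e) (r * s) := by
  intro k j h
  rw [coeff_mul, finsetSum_coeff]
  refine Finset.sum_eq_zero fun x hx => ?_
  rw [coeff_mul]
  refine Finset.sum_eq_zero fun y hy => ?_
  have hx := Finset.HasAntidiagonal.mem_antidiagonal.mp hx
  have hy := Finset.HasAntidiagonal.mem_antidiagonal.mp hy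
  by_cases h1 : d < y.1 + x.1
  · rw [hr _ _ h1, zero_mul]
  · rw [hs _ _ (by omega), mul_zero]

theorem HasWeight.mono {d e : ℕ} {r : ℂ[X][X]} (hr : HasWeight d r) (h : d ≤ e) :
    HasWeight e r := fun k j hkj => hr k j (h.trans_lt hkj)

theorem hasWeight_C_C (a : ℂ) : HasWeight 0 (C (C a)) := by
  intro k j h
  rw [coeff_C]
  split_ifs
  · rw [coeff_C_of_ne_zero (by omega)]
  · rw [coeff_zero]

theorem HasWeight.pow {d : ℕ} {r : ℂ[X][X]} (hr : HasWeight d r) (m : ℕ) :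
    HasWeight (m * d) (r ^ m) := by
  induction m with
  | zero => simpa using hasWeight_C_C 1
  | succ m ih =>
    rw [pow_succ, add_mul, one_mul]
    exact ih.mul hr

theorem hasWeight_sum {ι : Type*} {s : Finset ι} {d : ℕ} {f : ι → ℂ[X][X]}
    (h : ∀ i ∈ s, HasWeight d (f i)) : HasWeight d (∑ i ∈ s, f i) := by
  intro k j hkj
  rw [finsetSum_coeff, finsetSum_coeff]
  exact Finset.sum_eq_zero fun i hi => h i hi k j hkj

theorem hasWeight_prod {ι : Type*} {s : Finset ι} {d : ι → ℕ} {f : ι → ℂ[X][X]}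
    (h : ∀ i ∈ s, HasWeight (d i) (f i)) : HasWeight (∑ i ∈ s, d i) (∏ i ∈ s, f i) := by
  classical
  induction s using Finset.induction_on with
  | empty => simpa using hasWeight_C_C 1
  | insert i s hi ih =>
    rw [Finset.sum_insert hi, Finset.prod_insert hi]
    exact (h i (by simp)).mul (ih fun j hj => h j (by simp [hj]))

theorem hasWeight_aeval {σ : Type*} (p : MvPolynomial σ ℂ) {f : σ → ℂ[X][X]}
    (hf : ∀ i, HasWeight 1 (f i)) : HasWeight p.totalDegree (MvPolynomial.aeval f p) := by
  rw [MvPolynomial.aeval_def, MvPolynomial.eval₂_eq]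
  refine hasWeight_sum fun s hs => ?_
  refine ((hasWeight_C_C _).mul (hasWeight_prod fun i _ => (hf i).pow (s i))).mono ?_
  simpa [Finsupp.sum] using MvPolynomial.le_totalDegree hs

theorem HasWeight.natDegree_coeff_le {d : ℕ} {r : ℂ[X][X]} (hr : HasWeight d r) (k : ℕ) :
    (r.coeff k).natDegree ≤ d - k :=
  natDegree_le_iff_coeff_eq_zero.mpr fun j hj => hr k j (by omega)

theorem HasWeight.natDegree_le {d : ℕ} {r : ℂ[X][X]} (hr : HasWeight d r) : r.natDegree ≤ d :=
  natDegree_le_iff_coeff_eq_zero.mpr fun k hk => Polynomial.ext fun j => hr k j (by omega)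

end Weight

/-! ### Bivariate stable polynomials -/

section Bivariate

variable {p : MvPolynomial (Fin 2) ℂ}

/-- The polynomial `c⁻¹ p(x + y + e, y + e)` in the variable `y` over `ℂ[x]`. -/
noncomputable def shiftedPencil (p : MvPolynomial (Fin 2) ℂ) (c e : ℂ) : ℂ[X][X] :=
  C (C c⁻¹) * MvPolynomial.aeval ![X + C (X + C e), X + C (C e)] p

theorem map_shiftedPencil (p : MvPolynomial (Fin 2) ℂ) (c e x : ℂ) :
    (shiftedPencil p c e).map (evalRingHom x) =
      C c⁻¹ * restrictLine p ![x + e, e] ![1, 1] := by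
  rw [shiftedPencil, Polynomial.map_mul, Polynomial.map_C, coe_evalRingHom, eval_C, restrictLine,
    MvPolynomial.aeval_def, MvPolynomial.aeval_def, ← coe_mapRingHom, MvPolynomial.hom_eval₂]
  congr 2
  · ext; simp
  · funext i
    fin_cases i
    · simp [add_comm]
    · simp [add_comm]

theorem hasWeight_shiftedPencil (p : MvPolynomial (Fin 2) ℂ) (c e : ℂ) :
    HasWeight p.totalDegree (shiftedPencil p c e) := by
  rw [← zero_add p.totalDegree]
  refine (hasWeight_C_C _).mul (hasWeight_aeval p fun i k j h => ?_)
  fin_cases i <;> rcases k with _ | _ | k <;> rcases j with _ | _ | j <;>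
    simp [coeff_X, coeff_C, coeff_one] <;> omega

theorem coeff_shiftedPencil (p : MvPolynomial (Fin 2) ℂ)
    (hc : (restrictLine p 0 ![1, 1]).coeff p.totalDegree ≠ 0) (e : ℂ) :
    (shiftedPencil p ((restrictLine p 0 ![1, 1]).coeff p.totalDegree) e).coeff p.totalDegree =
      1 := by
  set c := (restrictLine p 0 ![1, 1]).coeff p.totalDegree with hcdef
  have hdeg : (restrictLine p 0 ![1, 1]).natDegree = p.totalDegree :=
    le_antisymm (natDegree_restrictLine_le p _ _) (le_natDegree_of_ne_zero hc)
  have hw := hasWeight_shiftedPencil p c e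
  have hline : restrictLine p ![0 + e, e] ![1, 1] = taylor e (restrictLine p 0 ![1, 1]) := by
    refine Polynomial.funext fun s => ?_
    rw [taylor_eval, eval_restrictLine, eval_restrictLine]
    congr 2
    funext i
    fin_cases i <;> simp [add_comm]
  have h0 : ((shiftedPencil p c e).coeff p.totalDegree).coeff 0 = 1 := by
    rw [coeff_zero_eq_eval_zero, ← coe_evalRingHom, ← coeff_map, map_shiftedPencil, coeff_C_mul,
      hline, ← hdeg, coeff_taylor_natDegree, leadingCoeff, hdeg, ← hcdef, inv_mul_cancel₀ hc]
  rw [eq_C_of_natDegree_le_zero ((hw.natDegree_coeff_le _).trans_eq (Nat.sub_self _)), h0, C_1]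

/-- A Hermitian matrix `M` such that `z₁ M + z₂ (1 - M)` is nonsingular on the product of upper
half-planes is positive semidefinite. -/
theorem posSemidef_of_det_ne_zero {ι : Type*} [Fintype ι] [DecidableEq ι] {M : Matrix ι ι ℂ}
    (hM : M.IsHermitian)
    (h : ∀ z w : ℂ, 0 < z.im → 0 < w.im → (z • M + w • (1 - M)).det ≠ 0) : M.PosSemidef := by
  rw [hM.posSemidef_iff_eigenvalues_nonneg]
  intro i
  by_contra! hi
  rw [Pi.zero_apply] at hi
  set μ : ℝ := hM.eigenvalues i with hμ
  refine h (((1 - μ : ℝ) : ℂ) * Complex.I) (((-μ : ℝ) : ℂ) * Complex.I) ?_ ?_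
    (exists_mulVec_eq_zero_iff.mp ⟨hM.eigenvectorBasis i, ?_, ?_⟩)
  · simp only [Complex.im_ofReal_mul, Complex.I_im]
    linarith
  · simp only [Complex.im_ofReal_mul, Complex.I_im]
    linarith
  · exact fun h0 => hM.eigenvectorBasis.orthonormal.ne_zero i (by ext k; exact congrFun h0 k)
  · rw [add_mulVec, smul_mulVec, smul_mulVec, sub_mulVec, one_mulVec, hM.mulVec_eigenvectorBasis]
    ext k
    simp [← hμ]
    ring

theorem exists_hermitian_representation {n : ℕ}
    (hp : ∀ z : Fin 2 → ℂ, (∀ i, 0 < (z i).im) → MvPolynomial.eval z p ≠ 0)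
    (hn : p.totalDegree = n + 1) :
    ∃ (A B : Matrix (Fin (n + 1)) (Fin (n + 1)) ℂ) (c : ℂ), (imPart A).PosSemidef ∧ Bᴴ = B ∧
      ∀ z w : ℂ, MvPolynomial.eval ![z, w] p = c * (A + z • B + w • (1 - B)).det := by
  set c := (restrictLine p 0 ![1, 1]).coeff p.totalDegree with hcdef
  have hc : c ≠ 0 := by
    have h1 := coeff_restrictLine_ne_zero hp (z := Complex.I • ![1, 1])
      (fun i => by fin_cases i <;> simp)
    rw [coeff_restrictLine_smul] at h1
    exact left_ne_zero_of_mul h1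
  obtain ⟨A, B, hA, hB, hAB⟩ := exists_limit_representation (ι := Fin (n + 1))
      (fun z => C c⁻¹ * restrictLine p ![z, 0] ![1, 1]) fun ε hε => by
    set e : ℂ := ε * Complex.I with he
    have hw := hasWeight_shiftedPencil p c e
    have hcoeff := coeff_shiftedPencil p hc e
    rw [← hcdef, hn] at hcoeff
    rw [hn] at hw
    have hdeg : (shiftedPencil p c e).natDegree = n + 1 :=
      le_antisymm hw.natDegree_le (le_natDegree_of_ne_zero (by rw [hcoeff]; exact one_ne_zero))
    obtain ⟨A, B, hA, hB, hAB⟩ := exists_representation_of_roots_im_neg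
      (by rw [Monic, leadingCoeff, hdeg, hcoeff]) hdeg hw.natDegree_coeff_le fun x y hxy => by
        rw [map_shiftedPencil, eval_mul, eval_C, eval_restrictLine] at hxy
        by_contra! hy
        refine hp _ (fun i => ?_) ((mul_eq_zero.mp hxy).resolve_left (inv_ne_zero hc))
        fin_cases i <;> simp [he] <;> linarith
    refine ⟨A - e • 1, B, ?_, hB, fun z => ?_⟩
    · convert hA using 1
      rw [imPart, conjTranspose_sub, conjTranspose_smul, conjTranspose_one, he]
      ext i j
      simp only [Matrix.add_apply, Matrix.sub_apply, Matrix.smul_apply, smul_eq_mul]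
      simp
      field_simp
      linear_combination 2 * ε * (1 : Matrix (Fin (n + 1)) (Fin (n + 1)) ℂ) i j * Complex.I_sq
    · refine Polynomial.funext fun y => ?_
      have h1 := congrArg (eval (y - e)) (hAB z)
      rw [map_shiftedPencil, eval_charpoly, eval_mul, eval_C, eval_restrictLine] at h1
      rw [eval_charpoly, eval_mul, eval_C, eval_restrictLine]
      convert h1.symm using 2
      · simp only [scalar_apply, ← smul_one_eq_diagonal, sub_smul]
        abel
      · congr 2
        funext i
        fin_cases i <;> simp
  refine ⟨A, B, c, hA, hB, fun z w => ?_⟩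
  have h1 := congrArg (eval w) (hAB (z - w))
  rw [eval_charpoly, eval_mul, eval_C, eval_restrictLine] at h1
  have h2 : A + z • B + w • (1 - B) = scalar _ w - -(A + (z - w) • B) := by
    simp only [scalar_apply, ← smul_one_eq_diagonal, sub_smul, smul_sub]
    abel
  rw [h2, h1, mul_inv_cancel_left₀ hc]
  congr 2
  funext i
  fin_cases i <;> simp

theorem coeff_restrictLine_eq_det {n : ℕ} {A B : Matrix (Fin n) (Fin n) ℂ} {c : ℂ}
    (h : ∀ z w : ℂ, MvPolynomial.eval ![z, w] p = c * (A + z • B + w • (1 - B)).det) (z w : ℂ) :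
    (restrictLine p 0 ![z, w]).coeff n = c * (z • B + w • (1 - B)).det := by
  have h1 : restrictLine p 0 ![z, w] =
      C c * ((X : ℂ[X]) • (z • B + w • (1 - B)).map C + A.map C).det := by
    refine Polynomial.funext fun s => ?_
    rw [eval_restrictLine, eval_mul, eval_C, eval_det]
    have h3 : (fun i => (0 : Fin 2 → ℂ) i + ![z, w] i * s) = ![z * s, w * s] := by
      funext i
      fin_cases i <;> simp
    rw [h3, h]
    congr 2
    ext i j
    simp [evalMat_apply]
    ring
  have h2 := coeff_det_X_add_C_card (z • B + w • (1 - B)) A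
  rw [Fintype.card_fin] at h2
  rw [h1, coeff_C_mul, h2]

end Bivariate

end BivariateStable

open MvPolynomial Matrix
open scoped ComplexOrder

theorem two_variable_determinantal_representation (d : ℕ) (p : MvPolynomial (Fin 2) ℂ)
    (hstable : ∀ z : Fin 2 → ℂ, (∀ j, 0 < (z j).im) → eval z p ≠ 0)
    (hdeg : p.totalDegree = d) :
    ∃ (A B₁ B₂ : Matrix (Fin d) (Fin d) ℂ) (c : ℂ),
      ((2 * Complex.I)⁻¹ • (A - Aᴴ)).PosSemidef ∧
      B₁.PosSemidef ∧ B₂.PosSemidef ∧ B₁ + B₂ = 1 ∧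
      ∀ z₁ z₂ : ℂ, eval ![z₁, z₂] p = c * (A + z₁ • B₁ + z₂ • B₂).det := by
  cases d with
  | zero =>
    refine ⟨0, 0, 0, p.coeff 0, by simpa using PosSemidef.zero, PosSemidef.zero, PosSemidef.zero,
      Subsingleton.elim _ _, fun z w => ?_⟩
    rw [det_isEmpty, mul_one]
    conv_lhs => rw [totalDegree_eq_zero_iff_eq_C.mp hdeg, eval_C]
  | succ n =>
    obtain ⟨A, B, c, hA, hB, h⟩ :=
      BivariateStable.exists_hermitian_representation hstable hdeg
    have hdet (z w : ℂ) (hz : 0 < z.im) (hw : 0 < w.im) : (z • B + w • (1 - B)).det ≠ 0 := by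
      have h1 := BivariateStable.coeff_restrictLine_ne_zero hstable (z := ![z, w])
        (fun i => by fin_cases i <;> simpa)
      rw [hdeg, BivariateStable.coeff_restrictLine_eq_det h] at h1
      exact right_ne_zero_of_mul h1
    refine ⟨A, B, 1 - B, c, hA, BivariateStable.posSemidef_of_det_ne_zero hB hdet,
      BivariateStable.posSemidef_of_det_ne_zero (isHermitian_one.sub hB) fun z w hz hw => ?_,
      add_sub_cancel _ _, h⟩
    rw [sub_sub_cancel, add_comm (z • _)]
    exact hdet w z hw hz
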